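/- arXiv:1709.05276 — 8 statements merged into one kernel-verified Lean document; each statement's English description precedes it below -/
import Mathlib

section
/- Let p ∈ Δ7 be the distribution with p_{001} = p_{010} = p_{100} = 1/3 and all other entries equal to 0. Then p belongs to the topological closure of RBM_{3,2} in ℝ⁸ but p ∉ RBM_{3,2}; consequently, RBM_{3,2} is not a closed subset of ℝ⁸. -/
open Real

/-- A `2 × 2 × 2` real tensor. -/
abbrev Tensor : Type := Fin 2 → Fin 2 → Fin 2 → ℝ

/-- `p` is a probability distribution: nonnegative entries summing to 1 (membership in Δ₇). -/
def isDist (p : Tensor) : Prop :=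
  (∀ i j k, 0 ≤ p i j k) ∧ (∑ i, ∑ j, ∑ k, p i j k) = 1

/-- `q` is a nonnegative rank-one `2 × 2 × 2` tensor. -/
def rankOne (q : Tensor) : Prop :=
  ∃ a b c : Fin 2 → ℝ, (∀ i, 0 ≤ a i) ∧ (∀ i, 0 ≤ b i) ∧ (∀ i, 0 ≤ c i) ∧
    ∀ i j k, q i j k = a i * b j * c k

/-- Membership in the model `RBM_{3,2}`. -/
def inRBM32 (p : Tensor) : Prop :=
  isDist p ∧ ∃ q r s t : Tensor, rankOne q ∧ rankOne r ∧ rankOne s ∧ rankOne t ∧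
    ∀ i j k, p i j k = (q i j k + r i j k) * (s i j k + t i j k)

/-- Membership in the mixture model `M_{3,3}`. -/
def inM33 (p : Tensor) : Prop :=
  isDist p ∧ ∃ q r s : Tensor, rankOne q ∧ rankOne r ∧ rankOne s ∧
    ∀ i j k, p i j k = q i j k + r i j k + s i j k

def C1 (p : Tensor) : Prop :=
  p 0 0 0 * p 0 1 1 ≥ p 0 0 1 * p 0 1 0 ∧ p 1 0 0 * p 1 1 1 ≥ p 1 0 1 * p 1 1 0

def C2 (p : Tensor) : Prop :=
  p 0 0 0 * p 0 1 1 ≤ p 0 0 1 * p 0 1 0 ∧ p 1 0 0 * p 1 1 1 ≤ p 1 0 1 * p 1 1 0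

def C3 (p : Tensor) : Prop :=
  p 0 0 0 * p 1 0 1 ≥ p 0 0 1 * p 1 0 0 ∧ p 0 1 0 * p 1 1 1 ≥ p 0 1 1 * p 1 1 0

def C4 (p : Tensor) : Prop :=
  p 0 0 0 * p 1 0 1 ≤ p 0 0 1 * p 1 0 0 ∧ p 0 1 0 * p 1 1 1 ≤ p 0 1 1 * p 1 1 0

def C5 (p : Tensor) : Prop :=
  p 0 0 0 * p 1 1 0 ≥ p 1 0 0 * p 0 1 0 ∧ p 0 0 1 * p 1 1 1 ≥ p 1 0 1 * p 0 1 1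

def C6 (p : Tensor) : Prop :=
  p 0 0 0 * p 1 1 0 ≤ p 1 0 0 * p 0 1 0 ∧ p 0 0 1 * p 1 1 1 ≤ p 1 0 1 * p 0 1 1

/-- A sum of two nonnegative rank-one tensors that is nonzero at the three unit positions
is nonzero at the origin: one of the two boxes of support contains two of these positions. -/
lemma rankOne_add_rankOne_zero_ne_zero {q r : Tensor} (hq : rankOne q) (hr : rankOne r)
    (h₁ : q 0 0 1 + r 0 0 1 ≠ 0) (h₂ : q 0 1 0 + r 0 1 0 ≠ 0) (h₃ : q 1 0 0 + r 1 0 0 ≠ 0) :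
    q 0 0 0 + r 0 0 0 ≠ 0 := by
  obtain ⟨a, b, c, ha, hb, hc, hq⟩ := hq
  obtain ⟨a', b', c', ha', hb', hc', hr⟩ := hr
  simp only [hq, hr] at *
  intro h
  have hn := mul_nonneg (mul_nonneg (ha 0) (hb 0)) (hc 0)
  have hn' := mul_nonneg (mul_nonneg (ha' 0) (hb' 0)) (hc' 0)
  have h0 : a 0 * b 0 * c 0 = 0 := by linarith
  have h0' : a' 0 * b' 0 * c' 0 = 0 := by linarith
  simp only [mul_eq_zero] at h0 h0'
  rcases h0 with (h0 | h0) | h0 <;> rcases h0' with (h0' | h0') | h0' <;> simp_all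

/-- The distribution with weight `1` at the three unit positions and weight `e > 0` at the origin,
normalized, is in the model. -/
lemma inRBM32_perturbation {e : ℝ} (he : 0 < e) {x : Tensor}
    (hx : ∀ i j k : Fin 2,
      x i j k = (if (i, j, k) = ((0 : Fin 2), (0 : Fin 2), (0 : Fin 2)) then e else
        if (i, j, k) = ((0 : Fin 2), (0 : Fin 2), (1 : Fin 2)) ∨
           (i, j, k) = ((0 : Fin 2), (1 : Fin 2), (0 : Fin 2)) ∨
           (i, j, k) = ((1 : Fin 2), (0 : Fin 2), (0 : Fin 2)) then 1 else 0) / (3 + e)) :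
    inRBM32 x := by
  have h3 : 0 < 3 + e := by positivity
  refine ⟨⟨fun i j k => ?_, ?_⟩, fun i j k => ![1, 0] i * ![1, 1] j * ![1, 1] k,
    fun i j k => ![0, 1] i * ![1, 0] j * ![1, 0] k,
    fun i j k => ![e / (3 + e), 1 / (3 + e)] i * ![1, 1 / e] j * ![1, 0] k,
    fun i j k => ![1 / (3 + e), 0] i * ![1, 0] j * ![0, 1] k,
    ⟨_, _, _, ?_, ?_, ?_, fun _ _ _ => rfl⟩, ⟨_, _, _, ?_, ?_, ?_, fun _ _ _ => rfl⟩,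
    ⟨_, _, _, ?_, ?_, ?_, fun _ _ _ => rfl⟩, ⟨_, _, _, ?_, ?_, ?_, fun _ _ _ => rfl⟩, ?_⟩
  · rw [hx]
    refine div_nonneg ?_ h3.le
    split_ifs <;> positivity
  · simp [Fin.sum_univ_two, hx]
    field_simp
    ring
  iterate 12 simp [Fin.forall_fin_two, he.le, h3.le, div_nonneg]
  · intro i j k
    rw [hx]
    fin_cases i <;> fin_cases j <;> fin_cases k <;> simp
    all_goals field_simp

theorem stmt10 (p : Tensor)
    (hp : ∀ i j k : Fin 2,
      p i j k = if (i, j, k) = ((0 : Fin 2), (0 : Fin 2), (1 : Fin 2)) ∨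
                   (i, j, k) = ((0 : Fin 2), (1 : Fin 2), (0 : Fin 2)) ∨
                   (i, j, k) = ((1 : Fin 2), (0 : Fin 2), (0 : Fin 2)) then (1 : ℝ) / 3 else 0) :
    p ∈ closure {x : Tensor | inRBM32 x} ∧ ¬ inRBM32 p ∧
      ¬ IsClosed {x : Tensor | inRBM32 x} := by
  have hmem : p ∈ closure {x : Tensor | inRBM32 x} := by
    let f : ℝ → Tensor := fun e i j k =>
      (if (i, j, k) = ((0 : Fin 2), (0 : Fin 2), (0 : Fin 2)) then e else
        if (i, j, k) = ((0 : Fin 2), (0 : Fin 2), (1 : Fin 2)) ∨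
           (i, j, k) = ((0 : Fin 2), (1 : Fin 2), (0 : Fin 2)) ∨
           (i, j, k) = ((1 : Fin 2), (0 : Fin 2), (0 : Fin 2)) then 1 else 0) / (3 + e)
    have hf0 : f 0 = p := by
      ext i j k
      rw [hp]
      fin_cases i <;> fin_cases j <;> fin_cases k <;> simp [f]
    have hf : ContinuousAt f 0 := by
      refine continuousAt_pi.2 fun i => continuousAt_pi.2 fun j => continuousAt_pi.2 fun k => ?_
      refine ContinuousAt.div ?_ (by fun_prop) (by norm_num)
      split_ifs <;> fun_prop
    have hlim : Filter.Tendsto f (nhdsWithin 0 (Set.Ioi 0)) (nhds p) :=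
      hf0 ▸ hf.tendsto.mono_left nhdsWithin_le_nhds
    refine mem_closure_of_tendsto hlim ?_
    filter_upwards [self_mem_nhdsWithin] with e he
    exact inRBM32_perturbation he fun _ _ _ => rfl
  have hnot : ¬ inRBM32 p := by
    rintro ⟨-, q, r, s, t, hq, hr, hs, ht, h⟩
    have h₀ : p 0 0 0 = 0 := by simp [hp]
    have h₁ : p 0 0 1 ≠ 0 := by simp [hp]
    have h₂ : p 0 1 0 ≠ 0 := by simp [hp]
    have h₃ : p 1 0 0 ≠ 0 := by simp [hp]
    rw [h] at h₀ h₁ h₂ h₃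
    rw [mul_ne_zero_iff] at h₁ h₂ h₃
    exact mul_ne_zero (rankOne_add_rankOne_zero_ne_zero hq hr h₁.1 h₂.1 h₃.1)
      (rankOne_add_rankOne_zero_ne_zero hs ht h₁.2 h₂.2 h₃.2) h₀
  exact ⟨hmem, hnot, fun hc => hnot (hc.closure_subset hmem)⟩
end

section
/- Let p ∈ Δ7 be strictly positive and suppose at least one of the six slice determinants of p vanishes, i.e., p_{000}p_{011} = p_{001}p_{010}, or p_{100}p_{111} = p_{101}p_{110}, or p_{000}p_{101} = p_{001}p_{100}, or p_{010}p_{111} = p_{011}p_{110}, or p_{000}p_{110} = p_{010}p_{100}, or p_{001}p_{111} = p_{011}p_{101}. Then p ∈ RBM_{3,2} and p ∈ M_{3,3}. -/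
open Real

/-- The algebraic part of membership in both models, without the normalization. -/
def HasBothDecompositions (p : Tensor) : Prop :=
  (∃ q r s t : Tensor, rankOne q ∧ rankOne r ∧ rankOne s ∧ rankOne t ∧
    ∀ i j k, p i j k = (q i j k + r i j k) * (s i j k + t i j k)) ∧
  ∃ q r s : Tensor, rankOne q ∧ rankOne r ∧ rankOne s ∧
    ∀ i j k, p i j k = q i j k + r i j k + s i j k

/-- A nonnegative rank-one tensor from explicit coordinates of its factors. -/
lemma rankOne_mk {a₀ a₁ b₀ b₁ c₀ c₁ : ℝ} (ha₀ : 0 ≤ a₀) (ha₁ : 0 ≤ a₁) (hb₀ : 0 ≤ b₀)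
    (hb₁ : 0 ≤ b₁) (hc₀ : 0 ≤ c₀) (hc₁ : 0 ≤ c₁) :
    rankOne fun i j k => ![a₀, a₁] i * ![b₀, b₁] j * ![c₀, c₁] k := by
  refine ⟨_, _, _, ?_, ?_, ?_, fun _ _ _ => rfl⟩ <;>
    simpa [Fin.forall_fin_two] using ⟨by assumption, by assumption⟩

/-- A positive tensor whose first slice in the first direction is singular lies in both models. -/
lemma hasBothDecompositions_of_slice (p : Tensor) (hpos : ∀ i j k, 0 < p i j k)
    (h : p 0 0 0 * p 0 1 1 = p 0 0 1 * p 0 1 0) : HasBothDecompositions p := by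
  have pos : ∀ i j k, 0 ≤ p i j k := fun i j k => (hpos i j k).le
  have h000 := hpos 0 0 0
  have h100 := hpos 1 0 0
  have h101 := hpos 1 0 1
  have h110 := hpos 1 1 0
  have h111 := hpos 1 1 1
  have h011 : p 0 1 1 = p 0 1 0 / p 0 0 0 * p 0 0 1 := by
    field_simp
    linarith
  have R₀ := rankOne_mk zero_le_one le_rfl zero_le_one
    (div_nonneg (pos 0 1 0) (pos 0 0 0)) (pos 0 0 0) (pos 0 0 1)
  refine ⟨?_, ?_⟩
  · have R₁ := rankOne_mk zero_le_one zero_le_one zero_le_one zero_le_one zero_le_one zero_le_one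
    rcases le_total (p 1 0 1 * p 1 1 0) (p 1 0 0 * p 1 1 1) with hle | hle
    · have ht : 0 ≤ p 1 0 0 * p 1 1 1 / (p 1 0 1 * p 1 1 0) - 1 := by
        rw [sub_nonneg, one_le_div (by positivity)]
        exact hle
      refine ⟨_, _, _, _, R₀,
        rankOne_mk le_rfl zero_le_one (div_nonneg (pos 1 0 1) (pos 1 1 1)) zero_le_one
          (pos 1 1 0) (pos 1 1 1), R₁,
        rankOne_mk le_rfl zero_le_one ht le_rfl zero_le_one le_rfl, ?_⟩
      simp only [Fin.forall_fin_two]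
      simp [h011]
      refine ⟨?_, ?_⟩
      · field_simp
      · field_simp
        simp
    · have ht : 0 ≤ p 1 0 1 * p 1 1 0 / (p 1 0 0 * p 1 1 1) - 1 := by
        rw [sub_nonneg, one_le_div (by positivity)]
        exact hle
      refine ⟨_, _, _, _, R₀,
        rankOne_mk le_rfl zero_le_one (div_nonneg (pos 1 0 0) (pos 1 1 0)) zero_le_one
          (pos 1 1 0) (pos 1 1 1), R₁,
        rankOne_mk le_rfl zero_le_one ht le_rfl le_rfl zero_le_one, ?_⟩
      simp only [Fin.forall_fin_two]
      simp [h011]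
      refine ⟨?_, ?_⟩
      · field_simp
      · field_simp
        simp
  · refine ⟨_, _, _, R₀,
      rankOne_mk le_rfl zero_le_one zero_le_one le_rfl (pos 1 0 0) (pos 1 0 1),
      rankOne_mk le_rfl zero_le_one le_rfl zero_le_one (pos 1 1 0) (pos 1 1 1), ?_⟩
    simp only [Fin.forall_fin_two]
    simp [h011]
    field_simp

/-- An involution of the algebra of tensors that preserves rank-one tensors. -/
structure IsSymmetry (T : Tensor → Tensor) : Prop where
  involutive : ∀ p, T (T p) = p
  map_rankOne : ∀ q, rankOne q → rankOne (T q)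
  map_add : ∀ p q, T (p + q) = T p + T q
  map_mul : ∀ p q, T (p * q) = T p * T q

lemma HasBothDecompositions.of_symmetry {T : Tensor → Tensor} (hT : IsSymmetry T) {p : Tensor}
    (h : HasBothDecompositions (T p)) : HasBothDecompositions p := by
  obtain ⟨⟨q, r, s, t, hq, hr, hs, ht, e⟩, ⟨q', r', s', hq', hr', hs', e'⟩⟩ := h
  have E : T p = (q + r) * (s + t) := by
    funext i j k
    exact e i j k
  have E' : T p = q' + r' + s' := by
    funext i j k
    exact e' i j k
  refine ⟨⟨T q, T r, T s, T t, hT.map_rankOne _ hq, hT.map_rankOne _ hr, hT.map_rankOne _ hs,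
    hT.map_rankOne _ ht, fun i j k => ?_⟩, ⟨T q', T r', T s', hT.map_rankOne _ hq',
    hT.map_rankOne _ hr', hT.map_rankOne _ hs', fun i j k => ?_⟩⟩
  · rw [← hT.involutive p, E, hT.map_mul, hT.map_add, hT.map_add]
    rfl
  · rw [← hT.involutive p, E', hT.map_add, hT.map_add]
    rfl

lemma isSymmetry_flip : IsSymmetry fun p i j k => p (1 - i) j k where
  involutive p := by simp
  map_rankOne := by
    rintro q ⟨a, b, c, ha, hb, hc, e⟩
    exact ⟨fun i => a (1 - i), b, c, fun i => ha _, hb, hc, fun i j k => e _ j k⟩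
  map_add _ _ := rfl
  map_mul _ _ := rfl

lemma isSymmetry_swap_first_second : IsSymmetry fun p i j k => p j i k where
  involutive _ := rfl
  map_rankOne := by
    rintro q ⟨a, b, c, ha, hb, hc, e⟩
    exact ⟨b, a, c, hb, ha, hc, fun i j k => (e j i k).trans (by ring)⟩
  map_add _ _ := rfl
  map_mul _ _ := rfl

lemma isSymmetry_swap_first_third : IsSymmetry fun p i j k => p k j i where
  involutive _ := rfl
  map_rankOne := by
    rintro q ⟨a, b, c, ha, hb, hc, e⟩
    exact ⟨c, b, a, hc, hb, ha, fun i j k => (e k j i).trans (by ring)⟩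
  map_add _ _ := rfl
  map_mul _ _ := rfl

/-- A positive tensor with a singular slice in the first direction lies in both models. -/
lemma hasBothDecompositions_of_slices (p : Tensor) (hpos : ∀ i j k, 0 < p i j k)
    (h : p 0 0 0 * p 0 1 1 = p 0 0 1 * p 0 1 0 ∨ p 1 0 0 * p 1 1 1 = p 1 0 1 * p 1 1 0) :
    HasBothDecompositions p := by
  rcases h with h | h
  · exact hasBothDecompositions_of_slice p hpos h
  · exact .of_symmetry isSymmetry_flip
      (hasBothDecompositions_of_slice _ (fun i j k => hpos _ j k) (by simpa using h))

theorem stmt11 (p : Tensor) (hp : isDist p) (hpos : ∀ i j k, 0 < p i j k)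
    (hdet : p 0 0 0 * p 0 1 1 = p 0 0 1 * p 0 1 0 ∨
            p 1 0 0 * p 1 1 1 = p 1 0 1 * p 1 1 0 ∨
            p 0 0 0 * p 1 0 1 = p 0 0 1 * p 1 0 0 ∨
            p 0 1 0 * p 1 1 1 = p 0 1 1 * p 1 1 0 ∨
            p 0 0 0 * p 1 1 0 = p 0 1 0 * p 1 0 0 ∨
            p 0 0 1 * p 1 1 1 = p 0 1 1 * p 1 0 1) :
    inRBM32 p ∧ inM33 p := by
  suffices h : HasBothDecompositions p from ⟨⟨hp, h.1⟩, ⟨hp, h.2⟩⟩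
  rcases hdet with h | h | h | h | h | h
  · exact hasBothDecompositions_of_slices p hpos (.inl h)
  · exact hasBothDecompositions_of_slices p hpos (.inr h)
  · exact .of_symmetry isSymmetry_swap_first_second
      (hasBothDecompositions_of_slices _ (fun i j k => hpos j i k) (.inl h))
  · exact .of_symmetry isSymmetry_swap_first_second
      (hasBothDecompositions_of_slices _ (fun i j k => hpos j i k) (.inr h))
  · exact .of_symmetry isSymmetry_swap_first_third
      (hasBothDecompositions_of_slices _ (fun i j k => hpos k j i)
        (.inl (h.trans (mul_comm _ _))))
  · exact .of_symmetry isSymmetry_swap_first_third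
      (hasBothDecompositions_of_slices _ (fun i j k => hpos k j i)
        (.inr (h.trans (mul_comm _ _))))
end

section
/- Let p ∈ Δ7 be strictly positive with p ∈ M_{3,3}, and suppose that every neighbourhood of p in ℝ⁸ contains a point of Δ7 not belonging to M_{3,3} (i.e., p lies in the boundary of the model M_{3,3} relative to the simplex). Then at least one of the six slice determinants of p vanishes: p_{000}p_{011} = p_{001}p_{010}, or p_{100}p_{111} = p_{101}p_{110}, or p_{000}p_{101} = p_{001}p_{100}, or p_{010}p_{111} = p_{011}p_{110}, or p_{000}p_{110} = p_{010}p_{100}, or p_{001}p_{111} = p_{011}p_{101}. -/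
open Real

/-- Nonnegative rank at most three. -/
def NonnegRankLEThree (p : Tensor) : Prop :=
  ∃ q r s : Tensor, rankOne q ∧ rankOne r ∧ rankOne s ∧
    ∀ i j k, p i j k = q i j k + r i j k + s i j k

/-- The product of the determinants of the two slices in the first direction. -/
def sliceDetMul (p : Tensor) : ℝ :=
  (p 0 0 0 * p 0 1 1 - p 0 0 1 * p 0 1 0) * (p 1 0 0 * p 1 1 1 - p 1 0 1 * p 1 1 0)

theorem rankOne.swap_left {q : Tensor} (h : rankOne q) : rankOne fun i j k => q j i k := by
  obtain ⟨a, b, c, ha, hb, hc, h⟩ := h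
  exact ⟨b, a, c, hb, ha, hc, fun i j k => (h _ _ _).trans (by ring)⟩

theorem rankOne.swap_outer {q : Tensor} (h : rankOne q) : rankOne fun i j k => q k j i := by
  obtain ⟨a, b, c, ha, hb, hc, h⟩ := h
  exact ⟨c, b, a, hc, hb, ha, fun i j k => (h _ _ _).trans (by ring)⟩

theorem rankOne.rev_right {q : Tensor} (h : rankOne q) : rankOne fun i j k => q i j k.rev := by
  obtain ⟨a, b, c, ha, hb, hc, h⟩ := h
  exact ⟨a, b, fun k => c k.rev, ha, hb, fun k => hc _, fun i j k => h _ _ _⟩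

theorem NonnegRankLEThree.of_swap_left {p : Tensor}
    (h : NonnegRankLEThree fun i j k => p j i k) : NonnegRankLEThree p := by
  obtain ⟨q, r, s, hq, hr, hs, h⟩ := h
  exact ⟨_, _, _, hq.swap_left, hr.swap_left, hs.swap_left, fun i j k => h j i k⟩

theorem NonnegRankLEThree.of_swap_outer {p : Tensor}
    (h : NonnegRankLEThree fun i j k => p k j i) : NonnegRankLEThree p := by
  obtain ⟨q, r, s, hq, hr, hs, h⟩ := h
  exact ⟨_, _, _, hq.swap_outer, hr.swap_outer, hs.swap_outer, fun i j k => h k j i⟩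

theorem NonnegRankLEThree.of_rev_right {p : Tensor}
    (h : NonnegRankLEThree fun i j k => p i j k.rev) : NonnegRankLEThree p := by
  obtain ⟨q, r, s, hq, hr, hs, h⟩ := h
  exact ⟨_, _, _, hq.rev_right, hr.rev_right, hs.rev_right,
    fun i j k => by simpa using h i j k.rev⟩

/-- If both slice determinants are nonnegative, subtracting a multiple of a matrix unit from each
slice leaves two slices of rank one. -/
theorem nonnegRankLEThree_of_sliceDet_nonneg {p : Tensor} (hpos : ∀ i j k, 0 < p i j k)
    (h : ∀ i, p i 0 1 * p i 1 0 ≤ p i 0 0 * p i 1 1) : NonnegRankLEThree p := by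
  have slice (i₀ : Fin 2) : rankOne fun i j k =>
      (if i = i₀ then 1 else 0) * ![p i₀ 0 1 / p i₀ 1 1, 1] j * p i₀ 1 k := by
    refine ⟨fun i => if i = i₀ then 1 else 0, ![p i₀ 0 1 / p i₀ 1 1, 1], p i₀ 1,
      fun i => by positivity, fun j => ?_, fun k => (hpos _ _ _).le, fun i j k => rfl⟩
    have := hpos i₀ 0 1
    have := hpos i₀ 1 1
    fin_cases j <;> simp <;> positivity
  refine ⟨fun i j k => (p i 0 0 - p i 0 1 * p i 1 0 / p i 1 1) * ![1, 0] j * ![1, 0] k, _, _,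
    ⟨_, _, _, fun i => ?_, fun j => ?_, fun k => ?_, fun i j k => rfl⟩, slice 0, slice 1,
    fun i j k => ?_⟩
  · rw [sub_nonneg, div_le_iff₀ (hpos _ _ _)]
    exact h i
  · fin_cases j <;> simp
  · fin_cases k <;> simp
  · have := (hpos 0 1 1).ne'
    have := (hpos 1 1 1).ne'
    fin_cases i <;> fin_cases j <;> fin_cases k <;> simp <;> field_simp <;> ring

theorem nonnegRankLEThree_of_sliceDetMul_pos {p : Tensor} (hpos : ∀ i j k, 0 < p i j k)
    (h : 0 < sliceDetMul p) : NonnegRankLEThree p := by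
  rcases mul_pos_iff.1 h with ⟨h0, h1⟩ | ⟨h0, h1⟩
  · refine nonnegRankLEThree_of_sliceDet_nonneg hpos fun i => ?_
    fin_cases i <;> simp <;> linarith
  · refine .of_rev_right (nonnegRankLEThree_of_sliceDet_nonneg (fun i j k => hpos _ _ _) fun i => ?_)
    fin_cases i <;> simp <;> linarith

/-- A nonnegative rank-one tensor is a nonnegative multiple of a product distribution. -/
theorem rankOne.exists_weight {q : Tensor} (h : rankOne q) : ∃ w x y z : ℝ, 0 ≤ w ∧
    x ∈ Set.Icc 0 1 ∧ y ∈ Set.Icc 0 1 ∧ z ∈ Set.Icc 0 1 ∧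
    ∀ i j k, q i j k = w * ![1 - x, x] i * ![1 - y, y] j * ![1 - z, z] k := by
  have normalize (a : Fin 2 → ℝ) (ha : ∀ i, 0 ≤ a i) :
      ∃ w x : ℝ, 0 ≤ w ∧ x ∈ Set.Icc 0 1 ∧ ∀ i, a i = w * ![1 - x, x] i := by
    have h0 := ha 0
    have h1 := ha 1
    rcases (add_nonneg h0 h1).eq_or_lt with hs | hs
    · refine ⟨0, 0, le_rfl, by simp, fun i => ?_⟩
      fin_cases i <;> simp <;> linarith
    · refine ⟨a 0 + a 1, a 1 / (a 0 + a 1), hs.le,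
        ⟨by positivity, (div_le_one hs).2 (by linarith)⟩, fun i => ?_⟩
      fin_cases i <;> simp <;> field_simp
      ring
  obtain ⟨a, b, c, ha, hb, hc, h⟩ := h
  obtain ⟨u, x, hu, hx, hax⟩ := normalize a ha
  obtain ⟨v, y, hv, hy, hby⟩ := normalize b hb
  obtain ⟨w, z, hw, hz, hcz⟩ := normalize c hc
  exact ⟨u * v * w, x, y, z, by positivity, hx, hy, hz, fun i j k => by
    rw [h, hax, hby, hcz]; ring⟩

/-- The determinant of `∑ r, u r • (1 - y r, y r) ⊗ (1 - z r, z r)`, by the Cauchy-Binet formula. -/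
def mixtureDet (u₁ u₂ u₃ y₁ y₂ y₃ z₁ z₂ z₃ : ℝ) : ℝ :=
  u₁ * u₂ * ((y₁ - y₂) * (z₁ - z₂)) + u₁ * u₃ * ((y₁ - y₃) * (z₁ - z₃)) +
    u₂ * u₃ * ((y₂ - y₃) * (z₂ - z₃))

theorem mixtureDet_smul (ε η u₁ u₂ u₃ y₁ y₂ y₃ z₁ z₂ z₃ : ℝ) :
    mixtureDet u₁ u₂ u₃ (ε * y₁) (ε * y₂) (ε * y₃) (η * z₁) (η * z₂) (η * z₃) =
      ε * η * mixtureDet u₁ u₂ u₃ y₁ y₂ y₃ z₁ z₂ z₃ := by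
  unfold mixtureDet
  ring

/-- `m` lies between `a` and `b`, in either order. -/
def Between (a m b : ℝ) : Prop := (a ≤ m ∧ m ≤ b) ∨ (b ≤ m ∧ m ≤ a)

theorem between_cases (a b c : ℝ) : Between b a c ∨ Between a b c ∨ Between a c b := by
  unfold Between
  grind

theorem mixtureDet_mul_nonneg {u₁ u₂ u₃ v₁ v₂ v₃ y₁ y₂ y₃ z₁ z₂ z₃ : ℝ}
    (hu₁ : 0 ≤ u₁) (hu₂ : 0 ≤ u₂) (hu₃ : 0 ≤ u₃) (hv₁ : 0 ≤ v₁) (hv₂ : 0 ≤ v₂) (hv₃ : 0 ≤ v₃)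
    (hy : Between y₁ y₂ y₃) (hz : Between z₁ z₂ z₃) :
    0 ≤ mixtureDet u₁ u₂ u₃ y₁ y₂ y₃ z₁ z₂ z₃ * mixtureDet v₁ v₂ v₃ y₁ y₂ y₃ z₁ z₂ z₃ := by
  have key : (0 ≤ (y₁ - y₂) * (z₁ - z₂) ∧ 0 ≤ (y₁ - y₃) * (z₁ - z₃) ∧
      0 ≤ (y₂ - y₃) * (z₂ - z₃)) ∨ ((y₁ - y₂) * (z₁ - z₂) ≤ 0 ∧ (y₁ - y₃) * (z₁ - z₃) ≤ 0 ∧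
      (y₂ - y₃) * (z₂ - z₃) ≤ 0) := by
    rcases hy with ⟨hy, hy'⟩ | ⟨hy, hy'⟩ <;> rcases hz with ⟨hz, hz'⟩ | ⟨hz, hz'⟩
    · exact .inl ⟨by nlinarith, by nlinarith, by nlinarith⟩
    · exact .inr ⟨by nlinarith, by nlinarith, by nlinarith⟩
    · exact .inr ⟨by nlinarith, by nlinarith, by nlinarith⟩
    · exact .inl ⟨by nlinarith, by nlinarith, by nlinarith⟩
  unfold mixtureDet
  generalize (y₁ - y₂) * (z₁ - z₂) = d₁₂ at *
  generalize (y₁ - y₃) * (z₁ - z₃) = d₁₃ at *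
  generalize (y₂ - y₃) * (z₂ - z₃) = d₂₃ at *
  rcases key with ⟨h₁₂, h₁₃, h₂₃⟩ | ⟨h₁₂, h₁₃, h₂₃⟩
  · positivity
  · rw [← neg_nonneg] at h₁₂ h₁₃ h₂₃
    rw [← neg_mul_neg]
    simp only [neg_add, ← mul_neg]
    positivity

/-- If each label is extremal in two of the three directions, slice determinants in two
different directions cannot both be positive. -/
theorem mixtureDet_not_pos {w₁ w₂ w₃ b₁ b₂ b₃ c₁ c₂ c₃ x₁ x₂ x₃ y₁ y₂ y₃ z₁ z₂ z₃ : ℝ}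
    (hw₁ : 0 ≤ w₁) (hw₂ : 0 ≤ w₂) (hw₃ : 0 ≤ w₃)
    (hb₁ : 0 ≤ b₁) (hb₂ : 0 ≤ b₂) (hb₃ : 0 ≤ b₃) (hc₁ : 0 ≤ c₁) (hc₂ : 0 ≤ c₂) (hc₃ : 0 ≤ c₃)
    (hx : x₂ ≤ x₁) (hx' : x₁ ≤ x₃) (hy : y₃ ≤ y₂) (hy' : y₂ ≤ y₁) (hz : z₁ ≤ z₃) (hz' : z₃ ≤ z₂)
    (hb : b₃ * (y₁ - y₂) ≤ b₂ * (y₁ - y₃)) (hc : c₂ * (z₃ - z₁) ≤ c₃ * (z₂ - z₁))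
    (hD₂ : 0 < mixtureDet (w₁ * b₁) (w₂ * b₂) (w₃ * b₃) x₁ x₂ x₃ z₁ z₂ z₃)
    (hD₃ : 0 < mixtureDet (w₁ * c₁) (w₂ * c₂) (w₃ * c₃) x₁ x₂ x₃ y₁ y₂ y₃) : False := by
  unfold mixtureDet at hD₂ hD₃
  rw [← sub_nonneg] at hx hx' hy hy' hz hz'
  have hx₃₂ : 0 ≤ x₃ - x₂ := by linarith
  have hy₁₃ : 0 ≤ y₁ - y₃ := by linarith
  have hz₂₁ : 0 ≤ z₂ - z₁ := by linarith
  have e₂ : 0 ≤ (w₂ * b₂) * (w₃ * b₃) * ((x₃ - x₂) * (z₂ - z₃)) := by positivity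
  have e₃ : 0 ≤ (w₂ * c₂) * (w₃ * c₃) * ((x₃ - x₂) * (y₂ - y₃)) := by positivity
  have l₂ : w₂ * b₂ * ((x₁ - x₂) * (z₂ - z₁)) < w₃ * b₃ * ((x₃ - x₁) * (z₃ - z₁)) :=
    lt_of_mul_lt_mul_left (a := w₁ * b₁) (by linarith) (by positivity)
  have l₃ : w₃ * c₃ * ((x₃ - x₁) * (y₁ - y₃)) < w₂ * c₂ * ((x₁ - x₂) * (y₁ - y₂)) :=
    lt_of_mul_lt_mul_left (a := w₁ * c₁) (by linarith) (by positivity)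
  have l := mul_lt_mul'' l₂ l₃ (by positivity) (by positivity)
  have m := mul_le_mul hb hc (by positivity) (by positivity)
  have := mul_le_mul_of_nonneg_left m
    (show 0 ≤ w₂ * w₃ * ((x₁ - x₂) * (x₃ - x₁)) by positivity)
  linarith

theorem Between.exists_sign {a m b : ℝ} (h : Between a m b) :
    ∃ ε : ℝ, ε ^ 2 = 1 ∧ ε * a ≤ ε * m ∧ ε * m ≤ ε * b := by
  rcases h with ⟨h, h'⟩ | ⟨h, h'⟩
  · exact ⟨1, by simp, by simpa, by simpa⟩
  · exact ⟨-1, by simp, by simpa, by simpa⟩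

/-- If the middle labels in the three directions are distinct, slice determinants cannot have
opposite signs in each of the last two directions. -/
theorem not_opposite_of_distinct_middles {w₁ w₂ w₃ x₁ x₂ x₃ y₁ y₂ y₃ z₁ z₂ z₃ : ℝ}
    (hw₁ : 0 ≤ w₁) (hw₂ : 0 ≤ w₂) (hw₃ : 0 ≤ w₃)
    (hy₁ : y₁ ∈ Set.Icc 0 1) (hy₂ : y₂ ∈ Set.Icc 0 1) (hy₃ : y₃ ∈ Set.Icc 0 1)
    (hz₁ : z₁ ∈ Set.Icc 0 1) (hz₂ : z₂ ∈ Set.Icc 0 1) (hz₃ : z₃ ∈ Set.Icc 0 1)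
    (hx : Between x₂ x₁ x₃) (hy : Between y₁ y₂ y₃) (hz : Between z₁ z₃ z₂)
    (hD₂ : mixtureDet (w₁ * (1 - y₁)) (w₂ * (1 - y₂)) (w₃ * (1 - y₃)) x₁ x₂ x₃ z₁ z₂ z₃ *
      mixtureDet (w₁ * y₁) (w₂ * y₂) (w₃ * y₃) x₁ x₂ x₃ z₁ z₂ z₃ < 0)
    (hD₃ : mixtureDet (w₁ * (1 - z₁)) (w₂ * (1 - z₂)) (w₃ * (1 - z₃)) x₁ x₂ x₃ y₁ y₂ y₃ *
      mixtureDet (w₁ * z₁) (w₂ * z₂) (w₃ * z₃) x₁ x₂ x₃ y₁ y₂ y₃ < 0) : False := by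
  obtain ⟨ε, hε, hx, hx'⟩ := hx.exists_sign
  obtain ⟨δ, hδ, hy, hy'⟩ := (show Between y₃ y₂ y₁ from hy.symm).exists_sign
  obtain ⟨η, hη, hz, hz'⟩ := hz.exists_sign
  replace hD₂ : mixtureDet (w₁ * (1 - y₁)) (w₂ * (1 - y₂)) (w₃ * (1 - y₃))
      (ε * x₁) (ε * x₂) (ε * x₃) (η * z₁) (η * z₂) (η * z₃) *
      mixtureDet (w₁ * y₁) (w₂ * y₂) (w₃ * y₃)
      (ε * x₁) (ε * x₂) (ε * x₃) (η * z₁) (η * z₂) (η * z₃) < 0 := by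
    rwa [mixtureDet_smul, mixtureDet_smul, mul_mul_mul_comm, mul_mul_mul_comm ε, ← sq, ← sq,
      hε, hη, one_mul, one_mul]
  replace hD₃ : mixtureDet (w₁ * (1 - z₁)) (w₂ * (1 - z₂)) (w₃ * (1 - z₃))
      (ε * x₁) (ε * x₂) (ε * x₃) (δ * y₁) (δ * y₂) (δ * y₃) *
      mixtureDet (w₁ * z₁) (w₂ * z₂) (w₃ * z₃)
      (ε * x₁) (ε * x₂) (ε * x₃) (δ * y₁) (δ * y₂) (δ * y₃) < 0 := by
    rwa [mixtureDet_smul, mixtureDet_smul, mul_mul_mul_comm, mul_mul_mul_comm ε, ← sq, ← sq,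
      hε, hδ, one_mul, one_mul]
  have hy₁' := sub_nonneg.2 hy₁.2
  have hz₁' := sub_nonneg.2 hz₁.2
  have hb : y₃ * (δ * y₁ - δ * y₂) ≤ y₂ * (δ * y₁ - δ * y₃) := by
    linarith [mul_le_mul_of_nonneg_left hy hy₁.1]
  have hb' : (1 - y₃) * (δ * y₁ - δ * y₂) ≤ (1 - y₂) * (δ * y₁ - δ * y₃) := by
    linarith [mul_le_mul_of_nonneg_left hy hy₁']
  have hc : z₂ * (η * z₃ - η * z₁) ≤ z₃ * (η * z₂ - η * z₁) := by
    linarith [mul_le_mul_of_nonneg_left hz' hz₁.1]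
  have hc' : (1 - z₂) * (η * z₃ - η * z₁) ≤ (1 - z₃) * (η * z₂ - η * z₁) := by
    linarith [mul_le_mul_of_nonneg_left hz' hz₁']
  have hy₂' := sub_nonneg.2 hy₂.2
  have hy₃' := sub_nonneg.2 hy₃.2
  have hz₂' := sub_nonneg.2 hz₂.2
  have hz₃' := sub_nonneg.2 hz₃.2
  rcases mul_neg_iff.1 hD₂ with ⟨h₂, -⟩ | ⟨-, h₂⟩ <;>
    rcases mul_neg_iff.1 hD₃ with ⟨h₃, -⟩ | ⟨-, h₃⟩
  · exact mixtureDet_not_pos hw₁ hw₂ hw₃ hy₁' hy₂' hy₃' hz₁' hz₂' hz₃'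
      hx hx' hy hy' hz hz' hb' hc' h₂ h₃
  · exact mixtureDet_not_pos hw₁ hw₂ hw₃ hy₁' hy₂' hy₃' hz₁.1 hz₂.1 hz₃.1
      hx hx' hy hy' hz hz' hb' hc h₂ h₃
  · exact mixtureDet_not_pos hw₁ hw₂ hw₃ hy₁.1 hy₂.1 hy₃.1 hz₁' hz₂' hz₃'
      hx hx' hy hy' hz hz' hb hc' h₂ h₃
  · exact mixtureDet_not_pos hw₁ hw₂ hw₃ hy₁.1 hy₂.1 hy₃.1 hz₁.1 hz₂.1 hz₃.1
      hx hx' hy hy' hz hz' hb hc h₂ h₃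

/-- Slice determinants of a mixture of three product distributions cannot have opposite signs in
all three directions. -/
theorem not_opposite_all {w₁ w₂ w₃ x₁ x₂ x₃ y₁ y₂ y₃ z₁ z₂ z₃ : ℝ}
    (hw₁ : 0 ≤ w₁) (hw₂ : 0 ≤ w₂) (hw₃ : 0 ≤ w₃)
    (hx₁ : x₁ ∈ Set.Icc 0 1) (hx₂ : x₂ ∈ Set.Icc 0 1) (hx₃ : x₃ ∈ Set.Icc 0 1)
    (hy₁ : y₁ ∈ Set.Icc 0 1) (hy₂ : y₂ ∈ Set.Icc 0 1) (hy₃ : y₃ ∈ Set.Icc 0 1)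
    (hz₁ : z₁ ∈ Set.Icc 0 1) (hz₂ : z₂ ∈ Set.Icc 0 1) (hz₃ : z₃ ∈ Set.Icc 0 1)
    (hD₁ : mixtureDet (w₁ * (1 - x₁)) (w₂ * (1 - x₂)) (w₃ * (1 - x₃)) y₁ y₂ y₃ z₁ z₂ z₃ *
      mixtureDet (w₁ * x₁) (w₂ * x₂) (w₃ * x₃) y₁ y₂ y₃ z₁ z₂ z₃ < 0)
    (hD₂ : mixtureDet (w₁ * (1 - y₁)) (w₂ * (1 - y₂)) (w₃ * (1 - y₃)) x₁ x₂ x₃ z₁ z₂ z₃ *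
      mixtureDet (w₁ * y₁) (w₂ * y₂) (w₃ * y₃) x₁ x₂ x₃ z₁ z₂ z₃ < 0)
    (hD₃ : mixtureDet (w₁ * (1 - z₁)) (w₂ * (1 - z₂)) (w₃ * (1 - z₃)) x₁ x₂ x₃ y₁ y₂ y₃ *
      mixtureDet (w₁ * z₁) (w₂ * z₂) (w₃ * z₃) x₁ x₂ x₃ y₁ y₂ y₃ < 0) : False := by
  have swap₁₂ (u₁ u₂ u₃ y₁ y₂ y₃ z₁ z₂ z₃ : ℝ) : mixtureDet u₂ u₁ u₃ y₂ y₁ y₃ z₂ z₁ z₃ =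
      mixtureDet u₁ u₂ u₃ y₁ y₂ y₃ z₁ z₂ z₃ := by unfold mixtureDet; ring
  have swap₂₃ (u₁ u₂ u₃ y₁ y₂ y₃ z₁ z₂ z₃ : ℝ) : mixtureDet u₁ u₃ u₂ y₁ y₃ y₂ z₁ z₃ z₂ =
      mixtureDet u₁ u₂ u₃ y₁ y₂ y₃ z₁ z₂ z₃ := by unfold mixtureDet; ring
  have same {u₁ u₂ u₃ y₁ y₂ y₃ z₁ z₂ z₃ : ℝ}
      (hu₁ : u₁ ∈ Set.Icc 0 1) (hu₂ : u₂ ∈ Set.Icc 0 1) (hu₃ : u₃ ∈ Set.Icc 0 1)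
      (h : mixtureDet (w₁ * (1 - u₁)) (w₂ * (1 - u₂)) (w₃ * (1 - u₃)) y₁ y₂ y₃ z₁ z₂ z₃ *
        mixtureDet (w₁ * u₁) (w₂ * u₂) (w₃ * u₃) y₁ y₂ y₃ z₁ z₂ z₃ < 0) :
      ¬ (Between y₁ y₂ y₃ ∧ Between z₁ z₂ z₃) ∧ ¬ (Between y₂ y₁ y₃ ∧ Between z₂ z₁ z₃) ∧
        ¬ (Between y₁ y₃ y₂ ∧ Between z₁ z₃ z₂) := by
    have a₁ := mul_nonneg hw₁ hu₁.1
    have a₂ := mul_nonneg hw₂ hu₂.1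
    have a₃ := mul_nonneg hw₃ hu₃.1
    have b₁ := mul_nonneg hw₁ (sub_nonneg.2 hu₁.2)
    have b₂ := mul_nonneg hw₂ (sub_nonneg.2 hu₂.2)
    have b₃ := mul_nonneg hw₃ (sub_nonneg.2 hu₃.2)
    refine ⟨fun ⟨hy, hz⟩ => h.not_ge (mixtureDet_mul_nonneg b₁ b₂ b₃ a₁ a₂ a₃ hy hz),
      fun ⟨hy, hz⟩ => h.not_ge ?_, fun ⟨hy, hz⟩ => h.not_ge ?_⟩
    · simpa only [swap₁₂] using mixtureDet_mul_nonneg b₂ b₁ b₃ a₂ a₁ a₃ hy hz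
    · simpa only [swap₂₃] using mixtureDet_mul_nonneg b₁ b₃ b₂ a₁ a₃ a₂ hy hz
  obtain ⟨n₁, n₂, n₃⟩ := same hx₁ hx₂ hx₃ hD₁
  obtain ⟨n₄, n₅, n₆⟩ := same hy₁ hy₂ hy₃ hD₂
  obtain ⟨n₇, n₈, n₉⟩ := same hz₁ hz₂ hz₃ hD₃
  rcases between_cases x₁ x₂ x₃ with hx | hx | hx <;>
    rcases between_cases y₁ y₂ y₃ with hy | hy | hy <;>
    first
    | exact n₇ ⟨hx, hy⟩
    | exact n₈ ⟨hx, hy⟩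
    | exact n₉ ⟨hx, hy⟩
    | rcases between_cases z₁ z₂ z₃ with hz | hz | hz <;>
      first
      | exact n₁ ⟨hy, hz⟩
      | exact n₂ ⟨hy, hz⟩
      | exact n₃ ⟨hy, hz⟩
      | exact n₄ ⟨hx, hz⟩
      | exact n₅ ⟨hx, hz⟩
      | exact n₆ ⟨hx, hz⟩
      | skip
  · exact not_opposite_of_distinct_middles hw₁ hw₂ hw₃ hy₁ hy₂ hy₃ hz₁ hz₂ hz₃
      hx hy hz hD₂
      hD₃
  · exact not_opposite_of_distinct_middles hw₁ hw₃ hw₂ hy₁ hy₃ hy₂ hz₁ hz₃ hz₂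
      hx.symm hy hz (by simpa only [swap₁₂, swap₂₃] using hD₂)
      (by simpa only [swap₁₂, swap₂₃] using hD₃)
  · exact not_opposite_of_distinct_middles hw₂ hw₁ hw₃ hy₂ hy₁ hy₃ hz₂ hz₁ hz₃
      hx hy hz.symm (by simpa only [swap₁₂, swap₂₃] using hD₂)
      (by simpa only [swap₁₂, swap₂₃] using hD₃)
  · exact not_opposite_of_distinct_middles hw₂ hw₃ hw₁ hy₂ hy₃ hy₁ hz₂ hz₃ hz₁
      hx.symm hy.symm hz (by simpa only [swap₁₂, swap₂₃] using hD₂)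
      (by simpa only [swap₁₂, swap₂₃] using hD₃)
  · exact not_opposite_of_distinct_middles hw₃ hw₁ hw₂ hy₃ hy₁ hy₂ hz₃ hz₁ hz₂
      hx hy.symm hz.symm (by simpa only [swap₁₂, swap₂₃] using hD₂)
      (by simpa only [swap₁₂, swap₂₃] using hD₃)
  · exact not_opposite_of_distinct_middles hw₃ hw₂ hw₁ hy₃ hy₂ hy₁ hz₃ hz₂ hz₁
      hx.symm hy.symm hz.symm (by simpa only [swap₁₂, swap₂₃] using hD₂)
      (by simpa only [swap₁₂, swap₂₃] using hD₃)

/-- A nonnegative mixture of three rank-one tensors has, in some direction, slice determinants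
which are not of opposite signs. -/
theorem NonnegRankLEThree.sliceDetMul_nonneg {p : Tensor} (h : NonnegRankLEThree p) :
    0 ≤ sliceDetMul p ∨ 0 ≤ sliceDetMul (fun i j k => p j i k) ∨
      0 ≤ sliceDetMul fun i j k => p k j i := by
  obtain ⟨q, r, s, hq, hr, hs, h⟩ := h
  obtain ⟨w₁, x₁, y₁, z₁, hw₁, hx₁, hy₁, hz₁, hq⟩ := hq.exists_weight
  obtain ⟨w₂, x₂, y₂, z₂, hw₂, hx₂, hy₂, hz₂, hr⟩ := hr.exists_weight
  obtain ⟨w₃, x₃, y₃, z₃, hw₃, hx₃, hy₃, hz₃, hs⟩ := hs.exists_weight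
  by_contra! hn
  refine not_opposite_all hw₁ hw₂ hw₃ hx₁ hx₂ hx₃ hy₁ hy₂ hy₃ hz₁ hz₂ hz₃
    (lt_of_eq_of_lt ?_ hn.1) (lt_of_eq_of_lt ?_ hn.2.1) (lt_of_eq_of_lt ?_ hn.2.2) <;>
  · simp only [mixtureDet, sliceDetMul, h, hq, hr, hs, Matrix.cons_val_zero, Matrix.cons_val_one]
    congr 1 <;> ring

theorem stmt12 (p : Tensor) (hp : isDist p) (hpos : ∀ i j k, 0 < p i j k)
    (hmem : inM33 p)
    (hbd : p ∈ closure {x : Tensor | isDist x ∧ ¬ inM33 x}) :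
    p 0 0 0 * p 0 1 1 = p 0 0 1 * p 0 1 0 ∨
    p 1 0 0 * p 1 1 1 = p 1 0 1 * p 1 1 0 ∨
    p 0 0 0 * p 1 0 1 = p 0 0 1 * p 1 0 0 ∨
    p 0 1 0 * p 1 1 1 = p 0 1 1 * p 1 1 0 ∨
    p 0 0 0 * p 1 1 0 = p 0 1 0 * p 1 0 0 ∨
    p 0 0 1 * p 1 1 1 = p 0 1 1 * p 1 0 1 := by
  by_contra! hne
  have nonneg_rank {x : Tensor} (hx : ∀ i j k, 0 < x i j k) (h : 0 < sliceDetMul x ∨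
      0 < sliceDetMul (fun i j k => x j i k) ∨ 0 < sliceDetMul fun i j k => x k j i) :
      NonnegRankLEThree x := by
    rcases h with h | h | h
    · exact nonnegRankLEThree_of_sliceDetMul_pos hx h
    · exact .of_swap_left (nonnegRankLEThree_of_sliceDetMul_pos (fun _ _ _ => hx _ _ _) h)
    · exact .of_swap_outer (nonnegRankLEThree_of_sliceDetMul_pos (fun _ _ _ => hx _ _ _) h)
  obtain ⟨h₁, h₂, h₃, h₄, h₅, h₆⟩ := hne
  rw [← sub_ne_zero] at h₁ h₂ h₃ h₄ h₅ h₆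
  have hpU : 0 < sliceDetMul p ∨ 0 < sliceDetMul (fun i j k => p j i k) ∨
      0 < sliceDetMul fun i j k => p k j i := by
    refine (NonnegRankLEThree.sliceDetMul_nonneg hmem.2).imp (fun h => h.lt_of_ne' ?_)
      (Or.imp (fun h => h.lt_of_ne' ?_) (fun h => h.lt_of_ne' ?_))
    · exact mul_ne_zero h₁ h₂
    · exact mul_ne_zero h₃ h₄
    · refine mul_ne_zero ?_ ?_
      · rwa [mul_comm (p 1 0 0)]
      · rwa [mul_comm (p 1 0 1)]
  have hopen : IsOpen {x : Tensor | (∀ i j k, 0 < x i j k) ∧ (0 < sliceDetMul x ∨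
      0 < sliceDetMul (fun i j k => x j i k) ∨ 0 < sliceDetMul fun i j k => x k j i)} := by
    simp only [Set.ofPred_and, Set.ofPred_or, Set.ofPred_forall, sliceDetMul]
    refine .inter (isOpen_iInter_of_finite fun i => isOpen_iInter_of_finite fun j =>
      isOpen_iInter_of_finite fun k => isOpen_lt (by fun_prop) (by fun_prop))
      (.union ?_ (.union ?_ ?_)) <;> exact isOpen_lt (by fun_prop) (by fun_prop)
  obtain ⟨x, ⟨hx, hxU⟩, hxd, hxn⟩ := mem_closure_iff.1 hbd _ hopen ⟨hpos, hpU⟩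
  exact hxn ⟨hxd, nonneg_rank hx hxU⟩
end

section
/- Let p ∈ Δ7 be strictly positive. Define q by q_{0jk} = (Σ_k' p_{0jk'})·(Σ_j' p_{0j'k}) / (Σ_{j',k'} p_{0j'k'}) and q_{1jk} = p_{1jk} for all j, k ∈ {0,1}. Then: (i) q ∈ Δ7 and q is strictly positive; (ii) q_{000}q_{011} = q_{001}q_{010}; (iii) D(p‖q) = Σ_{j,k} p_{0jk}·log( p_{0jk}·(Σ_{j',k'} p_{0j'k'}) / ((Σ_{k'} p_{0jk'})·(Σ_{j'} p_{0j'k})) ); and (iv) for every strictly positive r ∈ Δ7 with r_{000}r_{011} = r_{001}r_{010}, D(p‖q) ≤ D(p‖r), with equality only if r = q. -/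
open Real

/-- Kullback--Leibler divergence `D(p‖q) = ∑_{x : p_x > 0} p_x log(p_x / q_x)`. -/
noncomputable def KLdiv (p q : Tensor) : ℝ :=
  ∑ i, ∑ j, ∑ k, if 0 < p i j k then p i j k * Real.log (p i j k / q i j k) else 0

theorem mul_log_div_add_sub_nonneg {a b : ℝ} (ha : 0 < a) (hb : 0 < b) :
    0 ≤ a * Real.log (a / b) + (b - a) := by
  have h := Real.one_sub_inv_le_log_of_pos (div_pos ha hb)
  have h' := mul_le_mul_of_nonneg_left h ha.le
  have e : a * (1 - (a / b)⁻¹) = a - b := by field_simp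
  linarith

theorem eq_of_mul_log_div_add_sub_eq_zero {a b : ℝ} (ha : 0 < a) (hb : 0 < b)
    (h : a * Real.log (a / b) + (b - a) = 0) : b = a := by
  by_contra hne
  have hlt := Real.log_lt_sub_one_of_pos (div_pos hb ha) (by rwa [ne_eq, div_eq_one_iff_eq ha.ne'])
  have h' := mul_lt_mul_of_pos_left hlt ha
  have e : a * (b / a - 1) = b - a := by field_simp
  rw [← inv_div, Real.log_inv] at h
  linarith

theorem KLdiv_of_pos {p : Tensor} (hp : ∀ i j k, 0 < p i j k) (q : Tensor) :
    KLdiv p q = ∑ i, ∑ j, ∑ k, p i j k * Real.log (p i j k / q i j k) := by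
  simp [KLdiv, hp]

theorem KLdiv_eq_sum_add_sub {p q : Tensor} (hp : isDist p) (hq : isDist q)
    (hp0 : ∀ i j k, 0 < p i j k) :
    KLdiv p q = ∑ i, ∑ j, ∑ k, (p i j k * Real.log (p i j k / q i j k) +
      (q i j k - p i j k)) := by
  simp only [Finset.sum_add_distrib, Finset.sum_sub_distrib, hp.2, hq.2, KLdiv_of_pos hp0]
  ring

theorem KLdiv_nonneg {p q : Tensor} (hp : isDist p) (hq : isDist q)
    (hp0 : ∀ i j k, 0 < p i j k) (hq0 : ∀ i j k, 0 < q i j k) : 0 ≤ KLdiv p q := by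
  rw [KLdiv_eq_sum_add_sub hp hq hp0]
  exact Finset.sum_nonneg fun i _ => Finset.sum_nonneg fun j _ => Finset.sum_nonneg fun k _ =>
    mul_log_div_add_sub_nonneg (hp0 i j k) (hq0 i j k)

theorem eq_of_KLdiv_eq_zero {p q : Tensor} (hp : isDist p) (hq : isDist q)
    (hp0 : ∀ i j k, 0 < p i j k) (hq0 : ∀ i j k, 0 < q i j k) (h : KLdiv p q = 0) : q = p := by
  have hn i j k := mul_log_div_add_sub_nonneg (hp0 i j k) (hq0 i j k)
  rw [KLdiv_eq_sum_add_sub hp hq hp0, Finset.sum_eq_zero_iff_of_nonneg fun i _ =>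
    Finset.sum_nonneg fun j _ => Finset.sum_nonneg fun k _ => hn i j k] at h
  funext i j k
  have h1 := h i (Finset.mem_univ i)
  rw [Finset.sum_eq_zero_iff_of_nonneg fun j _ => Finset.sum_nonneg fun k _ => hn i j k] at h1
  have h2 := h1 j (Finset.mem_univ j)
  rw [Finset.sum_eq_zero_iff_of_nonneg fun k _ => hn i j k] at h2
  exact eq_of_mul_log_div_add_sub_eq_zero (hp0 i j k) (hq0 i j k) (h2 k (Finset.mem_univ k))

/-- Pythagorean identity for the projection onto the tensors with a rank-one `0`-slice. -/
theorem KLdiv_eq_KLdiv_add_KLdiv {p q r : Tensor} (hp : ∀ i j k, 0 < p i j k)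
    (hq : ∀ i j k, 0 < q i j k) (hr : ∀ i j k, 0 < r i j k)
    (hrow : ∀ j, ∑ k, q 0 j k = ∑ k, p 0 j k) (hcol : ∀ k, ∑ j, q 0 j k = ∑ j, p 0 j k)
    (hq1 : ∀ j k, q 1 j k = p 1 j k)
    (hqdet : q 0 0 0 * q 0 1 1 = q 0 0 1 * q 0 1 0)
    (hrdet : r 0 0 0 * r 0 1 1 = r 0 0 1 * r 0 1 0) :
    KLdiv p r = KLdiv p q + KLdiv q r := by
  have logdet {t : Tensor} (ht : ∀ i j k, 0 < t i j k)
      (hd : t 0 0 0 * t 0 1 1 = t 0 0 1 * t 0 1 0) :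
      Real.log (t 0 1 1) =
        Real.log (t 0 0 1) + Real.log (t 0 1 0) - Real.log (t 0 0 0) := by
    have h := congrArg Real.log hd
    rw [Real.log_mul (ht _ _ _).ne' (ht _ _ _).ne',
      Real.log_mul (ht _ _ _).ne' (ht _ _ _).ne'] at h
    linarith
  rw [KLdiv_of_pos hp, KLdiv_of_pos hp, KLdiv_of_pos hq]
  simp only [Real.log_div (hp _ _ _).ne' (hr _ _ _).ne',
    Real.log_div (hp _ _ _).ne' (hq _ _ _).ne', Real.log_div (hq _ _ _).ne' (hr _ _ _).ne',
    Fin.sum_univ_two, hq1, logdet hq hqdet, logdet hr hrdet] at hrow hcol ⊢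
  have h01 : q 0 0 1 = p 0 0 0 + p 0 0 1 - q 0 0 0 := by linarith [hrow 0]
  have h10 : q 0 1 0 = p 0 0 0 + p 0 1 0 - q 0 0 0 := by linarith [hcol 0]
  have h11 : q 0 1 1 = p 0 1 1 - p 0 0 0 + q 0 0 0 := by linarith [hrow 1]
  linear_combination
    (Real.log (r 0 0 1) - Real.log (q 0 0 1)) * h01 +
    (Real.log (r 0 1 0) - Real.log (q 0 1 0)) * h10 +
    (Real.log (r 0 0 1) + Real.log (r 0 1 0) - Real.log (r 0 0 0) -
      (Real.log (q 0 0 1) + Real.log (q 0 1 0) - Real.log (q 0 0 0))) * h11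

theorem stmt13 (p q : Tensor) (hp : isDist p) (hpos : ∀ i j k, 0 < p i j k)
    (hq0 : ∀ j k : Fin 2,
      q 0 j k = (∑ k', p 0 j k') * (∑ j', p 0 j' k) / (∑ j', ∑ k', p 0 j' k'))
    (hq1 : ∀ j k : Fin 2, q 1 j k = p 1 j k) :
    (isDist q ∧ ∀ i j k, 0 < q i j k) ∧
    q 0 0 0 * q 0 1 1 = q 0 0 1 * q 0 1 0 ∧
    KLdiv p q = ∑ j, ∑ k, p 0 j k *
      Real.log (p 0 j k * (∑ j', ∑ k', p 0 j' k') /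
        ((∑ k', p 0 j k') * (∑ j', p 0 j' k))) ∧
    ∀ r : Tensor, isDist r → (∀ i j k, 0 < r i j k) →
      r 0 0 0 * r 0 1 1 = r 0 0 1 * r 0 1 0 →
      KLdiv p q ≤ KLdiv p r ∧ (KLdiv p q = KLdiv p r → r = q) := by
  have hrowpos j : 0 < ∑ k', p 0 j k' :=
    Finset.sum_pos (fun k _ => hpos 0 j k) Finset.univ_nonempty
  have hcolpos k : 0 < ∑ j', p 0 j' k :=
    Finset.sum_pos (fun j _ => hpos 0 j k) Finset.univ_nonempty
  have htot : 0 < ∑ j', ∑ k', p 0 j' k' :=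
    Finset.sum_pos (fun j _ => hrowpos j) Finset.univ_nonempty
  have hqpos : ∀ i j k, 0 < q i j k := by
    intro i j k
    fin_cases i
    · exact (hq0 j k).symm ▸ div_pos (mul_pos (hrowpos j) (hcolpos k)) htot
    · exact (hq1 j k).symm ▸ hpos 1 j k
  have hrow j : ∑ k, q 0 j k = ∑ k, p 0 j k := by
    simp only [hq0, ← Finset.sum_div, ← Finset.mul_sum]
    rw [Finset.sum_comm (f := fun k j => p 0 j k), mul_div_cancel_right₀ _ htot.ne']
  have hcol k : ∑ j, q 0 j k = ∑ j, p 0 j k := by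
    simp only [hq0, ← Finset.sum_div, ← Finset.sum_mul]
    rw [mul_div_cancel_left₀ _ htot.ne']
  have hqdist : isDist q := by
    refine ⟨fun i j k => (hqpos i j k).le, ?_⟩
    rw [← hp.2, Fin.sum_univ_two]
    simp only [hrow, hq1]
    exact (Fin.sum_univ_two fun i => ∑ j, ∑ k, p i j k).symm
  have hqdet : q 0 0 0 * q 0 1 1 = q 0 0 1 * q 0 1 0 := by
    simp only [hq0]
    ring
  refine ⟨⟨hqdist, hqpos⟩, hqdet, ?_, fun r hr hrpos hrdet => ?_⟩
  · rw [KLdiv_of_pos hpos, Fin.sum_univ_two]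
    simp only [hq1, hq0, div_self (hpos _ _ _).ne', Real.log_one, mul_zero,
      Finset.sum_const_zero, add_zero, div_div_eq_mul_div]
  · have h := KLdiv_eq_KLdiv_add_KLdiv hpos hqpos hrpos hrow hcol hq1 hqdet hrdet
    refine ⟨?_, fun he => eq_of_KLdiv_eq_zero hqdist hr hqpos hrpos (by linarith)⟩
    linarith [KLdiv_nonneg hqdist hr hqpos hrpos]
end

section
/- For every p ∈ Δ7 there exists q ∈ M_{3,3} whose support contains the support of p and such that D(p‖q) ≤ (1/2)·log 2. -/
open Real

/-- The product of the marginals of `f`, normalised to have the same total mass as `f`. -/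
noncomputable def marginalProduct (f : Fin 2 → Fin 2 → ℝ) (j k : Fin 2) : ℝ :=
  (f j 0 + f j 1) * ((f 0 k + f 1 k) / (f 0 0 + f 0 1 + f 1 0 + f 1 1))

theorem marginalProduct_nonneg {f : Fin 2 → Fin 2 → ℝ} (hf : ∀ j k, 0 ≤ f j k) (j k : Fin 2) :
    0 ≤ marginalProduct f j k := by
  have := hf j 0; have := hf j 1; have := hf 0 k; have := hf 1 k
  have := hf 0 0; have := hf 0 1; have := hf 1 0; have := hf 1 1
  unfold marginalProduct
  positivity

theorem sum_marginalProduct (f : Fin 2 → Fin 2 → ℝ) :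
    marginalProduct f 0 0 + marginalProduct f 0 1 + marginalProduct f 1 0 + marginalProduct f 1 1 =
      f 0 0 + f 0 1 + f 1 0 + f 1 1 := by
  unfold marginalProduct
  by_cases h : f 0 0 + f 0 1 + f 1 0 + f 1 1 = 0
  · simp [h]
  · field_simp
    ring

theorem le_marginals {f : Fin 2 → Fin 2 → ℝ} (hf : ∀ j k, 0 ≤ f j k) (j k : Fin 2) :
    f j k ≤ f j 0 + f j 1 ∧ f j k ≤ f 0 k + f 1 k ∧
      f j k ≤ f 0 0 + f 0 1 + f 1 0 + f 1 1 := by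
  have := hf 0 0; have := hf 0 1; have := hf 1 0; have := hf 1 1
  fin_cases j <;> fin_cases k <;> refine ⟨?_, ?_, ?_⟩ <;> simp <;> linarith

theorem marginalProduct_pos {f : Fin 2 → Fin 2 → ℝ} (hf : ∀ j k, 0 ≤ f j k) {j k : Fin 2}
    (h : 0 < f j k) : 0 < marginalProduct f j k := by
  obtain ⟨h1, h2, h3⟩ := le_marginals hf j k
  exact mul_pos (h.trans_le h1) (div_pos (h.trans_le h2) (h.trans_le h3))

theorem mul_log_div_marginalProduct_le {f : Fin 2 → Fin 2 → ℝ} (hf : ∀ j k, 0 ≤ f j k)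
    (j k : Fin 2) :
    (if 0 < f j k then f j k * Real.log (f j k / marginalProduct f j k) else 0) ≤
      f j k * (Real.log 2 - 1 + (f 0 0 + f 0 1 + f 1 0 + f 1 1) / (2 * (f j 0 + f j 1))) := by
  split_ifs with h
  · obtain ⟨h1, h2, h3⟩ := le_marginals hf j k
    have hq := marginalProduct_pos hf h
    unfold marginalProduct at *
    set r := f j 0 + f j 1
    set c := f 0 k + f 1 k
    set w := f 0 0 + f 0 1 + f 1 0 + f 1 1
    have hr : 0 < r := h.trans_le h1
    have hc : 0 < c := h.trans_le h2
    have hw : 0 < w := h.trans_le h3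
    refine mul_le_mul_of_nonneg_left ?_ h.le
    have hle : f j k / (r * (c / w)) ≤ 2 * (w / (2 * r)) := by
      calc f j k / (r * (c / w)) ≤ c / (r * (c / w)) := by gcongr
        _ = 2 * (w / (2 * r)) := by field_simp
    have hlog := Real.log_le_log (div_pos h hq) hle
    rw [Real.log_mul two_ne_zero (by positivity)] at hlog
    have := Real.log_le_sub_one_of_pos (show 0 < w / (2 * r) by positivity)
    linarith
  · rw [le_antisymm (not_lt.mp h) (hf j k), zero_mul]

/-- Mutual information of two binary variables is at most `log 2`, in unnormalised form. -/
theorem sum_mul_log_div_marginalProduct_le {f : Fin 2 → Fin 2 → ℝ} (hf : ∀ j k, 0 ≤ f j k) :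
    (∑ j, ∑ k, if 0 < f j k then f j k * Real.log (f j k / marginalProduct f j k) else 0) ≤
      (f 0 0 + f 0 1 + f 1 0 + f 1 1) * Real.log 2 := by
  have := hf 0 0; have := hf 0 1; have := hf 1 0; have := hf 1 1
  have h (j : Fin 2) :
      (∑ k, if 0 < f j k then f j k * Real.log (f j k / marginalProduct f j k) else 0) ≤
        (f j 0 + f j 1) * (Real.log 2 - 1) + (f 0 0 + f 0 1 + f 1 0 + f 1 1) / 2 := by
    refine (Finset.sum_le_sum fun k _ => mul_log_div_marginalProduct_le hf j k).trans ?_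
    rw [← Finset.sum_mul, Fin.sum_univ_two, mul_add]
    gcongr
    rcases eq_or_ne (f j 0 + f j 1) 0 with h0 | h0
    · rw [h0, zero_mul]
      positivity
    · exact le_of_eq (by field_simp)
  rw [Fin.sum_univ_two]
  linarith [h 0, h 1]

/-- Keep the slice `i ≠ i₀` of `p` and replace the slice `i₀` by the product of its marginals. -/
noncomputable def factorSlice (p : Tensor) (i₀ : Fin 2) : Tensor := fun i j k =>
  if i = i₀ then marginalProduct (p i₀) j k else p i j k

theorem inM33_factorSlice {p : Tensor} (hp : isDist p) (i₀ : Fin 2) :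
    inM33 (factorSlice p i₀) := by
  obtain ⟨hp0, hp1⟩ := hp
  refine ⟨⟨fun i j k => ?_, ?_⟩, ?_⟩
  · unfold factorSlice
    split_ifs
    exacts [marginalProduct_nonneg (hp0 i₀) j k, hp0 i j k]
  · have h := sum_marginalProduct (p i₀)
    simp only [Fin.sum_univ_two] at hp1 ⊢
    fin_cases i₀ <;> simp [factorSlice] at h ⊢ <;> linarith
  · let edge (j₀ : Fin 2) : Tensor := fun i j k =>
      (if i = i₀ then 0 else 1) * (if j = j₀ then 1 else 0) * p (1 - i₀) j₀ k
    have hedge (j₀ : Fin 2) : rankOne (edge j₀) :=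
      ⟨_, _, _, fun i => by split_ifs <;> norm_num, fun j => by split_ifs <;> norm_num,
        fun k => hp0 (1 - i₀) j₀ k, fun _ _ _ => rfl⟩
    refine ⟨fun i j k => (if i = i₀ then 1 else 0) * (p i₀ j 0 + p i₀ j 1) *
      ((p i₀ 0 k + p i₀ 1 k) / (p i₀ 0 0 + p i₀ 0 1 + p i₀ 1 0 + p i₀ 1 1)),
      edge 0, edge 1, ⟨_, _, _, fun i => ?_, fun j => ?_, fun k => ?_, fun _ _ _ => rfl⟩,
      hedge 0, hedge 1, fun i j k => ?_⟩
    · split_ifs <;> norm_num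
    · exact add_nonneg (hp0 _ _ _) (hp0 _ _ _)
    · have := hp0 i₀ 0 k; have := hp0 i₀ 1 k
      have := hp0 i₀ 0 0; have := hp0 i₀ 0 1; have := hp0 i₀ 1 0; have := hp0 i₀ 1 1
      positivity
    · fin_cases i₀ <;> fin_cases i <;> fin_cases j <;>
        simp [factorSlice, marginalProduct, edge]

theorem KLdiv_factorSlice_le {p : Tensor} (hp : ∀ i j k, 0 ≤ p i j k) (i₀ : Fin 2) :
    KLdiv p (factorSlice p i₀) ≤
      (p i₀ 0 0 + p i₀ 0 1 + p i₀ 1 0 + p i₀ 1 1) * Real.log 2 := by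
  refine le_trans (le_of_eq ?_) (sum_mul_log_div_marginalProduct_le (hp i₀))
  rw [KLdiv, Finset.sum_eq_single i₀]
  · simp [factorSlice]
  · intro i _ hi
    refine Finset.sum_eq_zero fun j _ => Finset.sum_eq_zero fun k _ => ?_
    split_ifs with h
    · simp [factorSlice, hi, h.ne']
    · rfl
  · simp

theorem stmt14 (p : Tensor) (hp : isDist p) :
    ∃ q : Tensor, inM33 q ∧ (∀ i j k, 0 < p i j k → 0 < q i j k) ∧
      KLdiv p q ≤ (1 / 2) * Real.log 2 := by
  obtain ⟨i₀, hi₀⟩ : ∃ i₀, p i₀ 0 0 + p i₀ 0 1 + p i₀ 1 0 + p i₀ 1 1 ≤ 1 / 2 := by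
    have h := hp.2
    simp only [Fin.sum_univ_two] at h
    by_contra! hlt
    linarith [hlt 0, hlt 1]
  refine ⟨factorSlice p i₀, inM33_factorSlice hp i₀, fun i j k h => ?_,
    (KLdiv_factorSlice_le hp.1 i₀).trans
      (mul_le_mul_of_nonneg_right hi₀ (Real.log_nonneg one_le_two))⟩
  unfold factorSlice
  split_ifs with hi
  · subst hi
    exact marginalProduct_pos (hp.1 _) h
  · exact h
end

section
/- Let u⁺ ∈ Δ7 be the distribution with value 1/4 at the states 000, 011, 101, 110 and 0 at the states 001, 010, 100, 111. Then for every q ∈ M_{3,3} with q_{000}, q_{011}, q_{101}, q_{110} all positive, D(u⁺‖q) ≥ (1/2)·log 2. -/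
open Real

/-- The uniform distribution on the even-parity states `000, 011, 101, 110`. -/
noncomputable def uplus : Tensor := fun i j k =>
  if (i.val + j.val + k.val) % 2 = 0 then 1 / 4 else 0

/-- The uniform distribution on the odd-parity states `001, 010, 100, 111`. -/
noncomputable def uminus : Tensor := fun i j k =>
  if (i.val + j.val + k.val) % 2 = 0 then 0 else 1 / 4

/-- The coordinate `i` of `x` is nonzero and the other coordinates have weakly opposite sign. -/
def OddAt (x : Fin 3 → ℝ) (i : Fin 3) : Prop :=
  x i ≠ 0 ∧ ∀ j, j ≠ i → x i * x j ≤ 0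

/-- The `2 × 2` minors of a triple of plane vectors, in cyclic order. -/
def cyclicMinor (a : Fin 3 → Fin 2 → ℝ) : Fin 3 → ℝ :=
  ![a 1 0 * a 2 1 - a 1 1 * a 2 0, a 2 0 * a 0 1 - a 2 1 * a 0 0, a 0 0 * a 1 1 - a 0 1 * a 1 0]

/-- The Cauchy–Binet expression for a slice of a sum of three rank-one tensors. -/
def pairSum (a y z : Fin 3 → ℝ) : ℝ :=
  a 1 * a 2 * (y 0 * z 0) + a 2 * a 0 * (y 1 * z 1) + a 0 * a 1 * (y 2 * z 2)

lemma pairSum_comm (a y z : Fin 3 → ℝ) : pairSum a y z = pairSum a z y := by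
  simp only [pairSum]; ring

lemma pairSum_smul (a y z : Fin 3 → ℝ) (r s : ℝ) :
    pairSum a (r • y) (s • z) = r * s * pairSum a y z := by
  simp only [pairSum, Pi.smul_apply, smul_eq_mul]; ring

lemma pairSum_eq_of_distinct (a y z : Fin 3 → ℝ) {i j k : Fin 3}
    (hij : i ≠ j) (hik : i ≠ k) (hjk : j ≠ k) :
    pairSum a y z =
      a j * a k * (y i * z i) + a k * a i * (y j * z j) + a i * a j * (y k * z k) := by
  fin_cases i <;> fin_cases j <;> fin_cases k <;> simp_all [pairSum] <;> ring

lemma sum_eq_of_distinct (f : Fin 3 → ℝ) {i j k : Fin 3}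
    (hij : i ≠ j) (hik : i ≠ k) (hjk : j ≠ k) : ∑ t, f t = f i + f j + f k := by
  fin_cases i <;> fin_cases j <;> fin_cases k <;> simp_all [Fin.sum_univ_three] <;> ring

lemma sum_cyclicMinor_mul (a : Fin 3 → Fin 2 → ℝ) (e : Fin 2) :
    ∑ t, cyclicMinor a t * a t e = 0 := by
  fin_cases e <;> simp [cyclicMinor, Fin.sum_univ_three] <;> ring

lemma pairSum_nonneg {a y z : Fin 3 → ℝ} (ha : ∀ t, 0 ≤ a t) (h : ∀ t, 0 ≤ y t * z t) :
    0 ≤ pairSum a y z := by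
  unfold pairSum
  have := mul_nonneg (mul_nonneg (ha 1) (ha 2)) (h 0)
  have := mul_nonneg (mul_nonneg (ha 2) (ha 0)) (h 1)
  have := mul_nonneg (mul_nonneg (ha 0) (ha 1)) (h 2)
  linarith

/-- Two sign vectors with opposite slice determinants cannot have the same odd index. -/
lemma oddAt_ne {a : Fin 3 → Fin 2 → ℝ} {y z : Fin 3 → ℝ} (ha : ∀ t e, 0 ≤ a t e)
    (h0 : 0 < pairSum (fun t => a t 0) y z) (h1 : pairSum (fun t => a t 1) y z < 0)
    {i j : Fin 3} (hy : OddAt y i) (hz : OddAt z j) : i ≠ j := by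
  rintro rfl
  have key : ∀ t, 0 ≤ (y i • y) t * (z i • z) t := by
    intro t
    by_cases ht : t = i
    · subst ht
      exact mul_nonneg (mul_self_nonneg _) (mul_self_nonneg _)
    · exact mul_nonneg_of_nonpos_of_nonpos (hy.2 t ht) (hz.2 t ht)
  have k0 := pairSum_nonneg (fun t => ha t 0) key
  have k1 := pairSum_nonneg (fun t => ha t 1) key
  rw [pairSum_smul] at k0 k1
  have hne := mul_ne_zero hy.1 hz.1
  rcases lt_or_gt_of_ne hne with h | h
  · exact absurd k0 (not_le.2 (mul_neg_of_neg_of_pos h h0))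
  · exact absurd k1 (not_le.2 (mul_neg_of_pos_of_neg h h1))

/-- If two of three minors are positive and the third nonnegative, the vectors cannot all be
nonnegative. -/
lemma not_two_pos {a : Fin 3 → Fin 2 → ℝ} (ha : ∀ t e, 0 ≤ a t e) {r : ℝ} {i j k : Fin 3}
    (hij : i ≠ j) (hik : i ≠ k) (hjk : j ≠ k) (hi : 0 < r * cyclicMinor a i)
    (hj : 0 < r * cyclicMinor a j) (hk : 0 ≤ r * cyclicMinor a k) : False := by
  have hz : ∀ e, a i e = 0 := by
    intro e
    have h := sum_cyclicMinor_mul a e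
    rw [sum_eq_of_distinct _ hij hik hjk] at h
    have h1 := mul_nonneg hj.le (ha j e)
    have h2 := mul_nonneg hk (ha k e)
    have h3 : r * cyclicMinor a i * a i e ≤ 0 := by linear_combination r * h + h1 + h2
    by_contra hne
    exact absurd h3 (not_le.2 (mul_pos hi (lt_of_le_of_ne (ha i e) (Ne.symm hne))))
  have : cyclicMinor a j = 0 := by
    have h0 := hz 0
    have h1 := hz 1
    fin_cases i <;> fin_cases j <;> simp_all [cyclicMinor]
  simp [this] at hj

lemma exists_oddAt {a : Fin 3 → Fin 2 → ℝ} {y z : Fin 3 → ℝ} (ha : ∀ t e, 0 ≤ a t e)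
    (h0 : 0 < pairSum (fun t => a t 0) y z) (h1 : pairSum (fun t => a t 1) y z < 0) :
    ∃ i, OddAt (cyclicMinor a) i := by
  by_cases hx : cyclicMinor a = 0
  · exfalso
    have e0 := congrFun hx 0
    have e1 := congrFun hx 1
    have e2 := congrFun hx 2
    simp [cyclicMinor] at e0 e1 e2
    have key : ∀ t, a t 1 ^ 2 * pairSum (fun t => a t 0) y z
        = a t 0 ^ 2 * pairSum (fun t => a t 1) y z := by
      have e : ∀ s t, a s 0 * a t 1 = a t 0 * a s 1 := by
        intro s t
        fin_cases s <;> fin_cases t <;> simp <;> linarith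
      intro t
      simp only [pairSum]
      have : ∀ s u, a t 1 ^ 2 * (a s 0 * a u 0) = a t 0 ^ 2 * (a s 1 * a u 1) := by
        intro s u
        linear_combination a t 1 * a u 0 * e s t + a t 0 * a s 1 * e u t
      linear_combination (y 0 * z 0) * this 1 2 + (y 1 * z 1) * this 2 0 + (y 2 * z 2) * this 0 1
    have hz : ∀ t, a t 0 = 0 := by
      intro t
      by_contra hne
      have p1 := mul_neg_of_pos_of_neg (pow_pos (lt_of_le_of_ne (ha t 0) (Ne.symm hne)) 2) h1
      have p2 := mul_nonneg (sq_nonneg (a t 1)) h0.le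
      linarith [key t]
    simp [pairSum, hz] at h0
  · by_contra hno
    push Not at hno
    have main : ∀ i j k : Fin 3, i ≠ j → i ≠ k → j ≠ k →
        0 < cyclicMinor a i * cyclicMinor a j → 0 ≤ cyclicMinor a i * cyclicMinor a k → False := by
      intro i j k hij hik hjk hj hk
      have hi : cyclicMinor a i ≠ 0 := left_ne_zero_of_mul hj.ne'
      exact not_two_pos ha hij hik hjk (mul_self_pos.2 hi) hj hk
    obtain ⟨i, hi⟩ := Function.ne_iff.1 hx
    have hi' : cyclicMinor a i ≠ 0 := hi
    obtain ⟨j, hji, hj⟩ : ∃ j, j ≠ i ∧ 0 < cyclicMinor a i * cyclicMinor a j := by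
      by_contra hcon
      push Not at hcon
      exact hno i ⟨hi', hcon⟩
    obtain ⟨k, hik, hjk⟩ : ∃ k, i ≠ k ∧ j ≠ k := by
      clear * -
      revert i j; decide
    rcases le_or_gt 0 (cyclicMinor a i * cyclicMinor a k) with hk | hk
    · exact main i j k hji.symm hik hjk hj hk
    · refine hno k ⟨right_ne_zero_of_mul hk.ne, fun l hl => ?_⟩
      have hl' : l = i ∨ l = j := by
        clear * - hl hik hjk hji
        revert i j k l; decide
      rcases hl' with rfl | rfl
      · linarith
      · nlinarith [mul_neg_of_pos_of_neg hj hk, mul_self_pos.2 hi',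
          mul_pos (mul_self_pos.2 hi') (mul_self_pos.2 hi')]

/-- Slices of opposite determinant force one product of minors to dominate the other two. -/
lemma dominant_of_pairSum {a : Fin 3 → Fin 2 → ℝ} {x y z : Fin 3 → ℝ} (ha : ∀ t e, 0 ≤ a t e)
    (hx : ∀ e, ∑ t, x t * a t e = 0) {i j k : Fin 3}
    (hij : i ≠ j) (hik : i ≠ k) (hjk : j ≠ k)
    (hprod : pairSum (fun t => a t 0) y z * pairSum (fun t => a t 1) y z < 0)
    (xi : 0 < x i) (xj : x j ≤ 0) (xk : x k ≤ 0) (yj : 0 ≤ y j) (yk : y k ≤ 0)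
    (zj : z j ≤ 0) (zk : 0 ≤ z k) :
    x j * y j * z j + x k * y k * z k < x i * y i * z i := by
  by_contra! hle
  have neg : ∀ e, pairSum (fun t => a t e) y z ≤ 0 := by
    intro e
    have h := hx e
    rw [sum_eq_of_distinct _ hij hik hjk] at h
    have id : x i * pairSum (fun t => a t e) y z =
        - (a j e ^ 2 * (x j * (y k * z k))) - a k e ^ 2 * (x k * (y j * z j))
        + a j e * a k e * (x i * y i * z i - (x j * y j * z j + x k * y k * z k)) := by
      rw [pairSum_eq_of_distinct _ _ _ hij hik hjk]
      linear_combination (a k e * (y j * z j) + a j e * (y k * z k)) * h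
    have p1 := mul_nonneg (sq_nonneg (a j e))
      (mul_nonneg_of_nonpos_of_nonpos xj (mul_nonpos_of_nonpos_of_nonneg yk zk))
    have p2 := mul_nonneg (sq_nonneg (a k e))
      (mul_nonneg_of_nonpos_of_nonpos xk (mul_nonpos_of_nonneg_of_nonpos yj zj))
    have p3 := mul_nonneg (mul_nonneg (ha j e) (ha k e)) (sub_nonneg.2 hle)
    by_contra! hpos
    have := mul_pos xi hpos
    linarith
  exact absurd hprod (not_lt.2 (mul_nonneg_of_nonpos_of_nonpos (neg 0) (neg 1)))

lemma pairSum_smul_mul_neg {a : Fin 3 → Fin 2 → ℝ} {y z : Fin 3 → ℝ} {r s : ℝ}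
    (h0 : 0 < pairSum (fun t => a t 0) y z) (h1 : pairSum (fun t => a t 1) y z < 0)
    (hr : r ≠ 0) (hs : s ≠ 0) :
    pairSum (fun t => a t 0) (r • y) (s • z) * pairSum (fun t => a t 1) (r • y) (s • z) < 0 := by
  rw [pairSum_smul, pairSum_smul]
  have := mul_neg_of_pos_of_neg (mul_self_pos.2 (mul_ne_zero hr hs)) (mul_neg_of_pos_of_neg h0 h1)
  linarith

lemma sum_smul_cyclicMinor_mul (a : Fin 3 → Fin 2 → ℝ) (r : ℝ) (e : Fin 2) :
    ∑ t, (r • cyclicMinor a) t * a t e = 0 := by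
  simp only [Pi.smul_apply, smul_eq_mul, mul_assoc, ← Finset.mul_sum, sum_cyclicMinor_mul,
    mul_zero]

/-- The slices of a sum of three nonnegative rank-one tensors cannot have determinants of opposite
signs in all three directions. -/
lemma not_all_slices_opposite {a b c : Fin 3 → Fin 2 → ℝ} (ha : ∀ t e, 0 ≤ a t e)
    (hb : ∀ t e, 0 ≤ b t e) (hc : ∀ t e, 0 ≤ c t e)
    (a0 : 0 < pairSum (fun t => a t 0) (cyclicMinor b) (cyclicMinor c))
    (a1 : pairSum (fun t => a t 1) (cyclicMinor b) (cyclicMinor c) < 0)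
    (b0 : 0 < pairSum (fun t => b t 0) (cyclicMinor a) (cyclicMinor c))
    (b1 : pairSum (fun t => b t 1) (cyclicMinor a) (cyclicMinor c) < 0)
    (c0 : 0 < pairSum (fun t => c t 0) (cyclicMinor a) (cyclicMinor b))
    (c1 : pairSum (fun t => c t 1) (cyclicMinor a) (cyclicMinor b) < 0) : False := by
  obtain ⟨i, hi⟩ := exists_oddAt ha a0 a1
  obtain ⟨j, hj⟩ := exists_oddAt hb b0 b1
  obtain ⟨k, hk⟩ := exists_oddAt hc c0 c1
  have hjk := oddAt_ne ha a0 a1 hj hk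
  have hik := oddAt_ne hb b0 b1 hi hk
  have hij := oddAt_ne hc c0 c1 hi hj
  have ti := dominant_of_pairSum ha (sum_smul_cyclicMinor_mul a (cyclicMinor a i)) hij hik hjk
    (pairSum_smul_mul_neg a0 a1 hj.1 hk.1) (mul_self_pos.2 hi.1) (hi.2 j hij.symm)
    (hi.2 k hik.symm) (mul_self_nonneg _) (hj.2 k hjk.symm) (hk.2 j hjk) (mul_self_nonneg _)
  have tj := dominant_of_pairSum hb (sum_smul_cyclicMinor_mul b (cyclicMinor b j)) hij.symm hjk hik
    (pairSum_smul_mul_neg b0 b1 hi.1 hk.1) (mul_self_pos.2 hj.1) (hj.2 i hij)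
    (hj.2 k hjk.symm) (mul_self_nonneg _) (hi.2 k hik.symm) (hk.2 i hik) (mul_self_nonneg _)
  simp only [Pi.smul_apply, smul_eq_mul] at ti tj
  have tk := mul_nonneg (mul_nonneg_of_nonpos_of_nonpos (hi.2 k hik.symm) (hj.2 k hjk.symm))
    (mul_self_nonneg (cyclicMinor c k))
  linarith

/-- If the diagonal product of a nonnegative `2 × 2` block is at most its antidiagonal product, the
diagonal product times a product of two entries outside the block is at most `2⁻¹⁰`. -/
lemma block_bound {s t u v e f g h : ℝ} (hs : 0 ≤ s) (ht : 0 ≤ t) (hu : 0 ≤ u) (hv : 0 ≤ v)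
    (he : 0 ≤ e) (hf : 0 ≤ f) (hg : 0 ≤ g) (hh : 0 ≤ h)
    (hsum : s + t + u + v + e + f + g + h = 1) (hle : s * t ≤ u * v) :
    s * t * (e * f) ≤ 1 / 1024 := by
  set m := s + t + u + v with hm
  have hm0 : 0 ≤ m := by positivity
  have hm1 : m ≤ 1 := by linarith
  have h1 : 16 * (s * t) ≤ m ^ 2 := by
    have hcross : 4 * (s * t) ≤ (s + t) * (u + v) := by
      refine abs_le_of_sq_le_sq' ?_ (by positivity) |>.2
      have k1 : 4 * (s * t) ≤ (s + t) ^ 2 := by nlinarith [sq_nonneg (s - t)]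
      have k2 : 4 * (s * t) ≤ (u + v) ^ 2 := by nlinarith [sq_nonneg (u - v)]
      have := mul_le_mul k1 k2 (by positivity) (by positivity)
      linarith
    nlinarith [sq_nonneg (s - t), sq_nonneg (u - v)]
  have h2 : 4 * (e * f) ≤ (1 - m) ^ 2 := by
    have : (e + f) ^ 2 ≤ (1 - m) ^ 2 := pow_le_pow_left₀ (by positivity) (by linarith) 2
    nlinarith [sq_nonneg (e - f)]
  have h3 : m * (1 - m) ≤ 1 / 4 := by nlinarith [sq_nonneg (m - 1 / 2)]
  have h4 : (m * (1 - m)) ^ 2 ≤ (1 / 4) ^ 2 :=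
    pow_le_pow_left₀ (mul_nonneg hm0 (by linarith)) h3 2
  have h5 := mul_le_mul h1 h2 (by positivity) (by positivity)
  linarith

lemma even_prod_le_of_inM33 {q : Tensor} (hq : inM33 q) :
    q 0 0 0 * q 0 1 1 * q 1 0 1 * q 1 1 0 ≤ 1 / 1024 := by
  obtain ⟨⟨hn, hsum⟩, r, s, t, ⟨a₁, b₁, c₁, ha₁, hb₁, hc₁, hr⟩, ⟨a₂, b₂, c₂, ha₂, hb₂, hc₂, hs⟩,
    ⟨a₃, b₃, c₃, ha₃, hb₃, hc₃, ht⟩, hqe⟩ := hq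
  simp only [Fin.sum_univ_two] at hsum
  have n000 := hn 0 0 0
  have n001 := hn 0 0 1
  have n010 := hn 0 1 0
  have n011 := hn 0 1 1
  have n100 := hn 1 0 0
  have n101 := hn 1 0 1
  have n110 := hn 1 1 0
  have n111 := hn 1 1 1
  by_contra! hlt
  have face : ∀ {s t u v e f g h : ℝ}, 0 ≤ s → 0 ≤ t → 0 ≤ u → 0 ≤ v → 0 ≤ e → 0 ≤ f → 0 ≤ g →
      0 ≤ h → s + t + u + v + e + f + g + h = 1 → 1 / 1024 < s * t * (e * f) → u * v < s * t := by
    intro s t u v e f g h hs ht hu hv he hf hg hh h1 h2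
    by_contra! hle
    exact absurd (block_bound hs ht hu hv he hf hg hh h1 hle) (not_le.2 h2)
  have i0 := face n000 n011 n001 n010 n101 n110 n100 n111 (by linarith) (by linarith)
  have i1 := face n101 n110 n100 n111 n000 n011 n001 n010 (by linarith) (by linarith)
  have j0 := face n000 n101 n001 n100 n011 n110 n010 n111 (by linarith) (by linarith)
  have j1 := face n011 n110 n010 n111 n000 n101 n001 n100 (by linarith) (by linarith)
  have k0 := face n000 n110 n010 n100 n011 n101 n001 n111 (by linarith) (by linarith)
  have k1 := face n011 n101 n001 n111 n000 n110 n010 n100 (by linarith) (by linarith)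
  simp only [hqe, hr, hs, ht] at i0 i1 j0 j1 k0 k1
  refine not_all_slices_opposite (a := ![a₁, a₂, a₃]) (b := ![b₁, b₂, b₃]) (c := ![c₁, c₂, c₃])
    ?_ ?_ ?_ ?_ ?_ ?_ ?_ ?_ ?_
  · intro t e; fin_cases t <;> simp [ha₁, ha₂, ha₃]
  · intro t e; fin_cases t <;> simp [hb₁, hb₂, hb₃]
  · intro t e; fin_cases t <;> simp [hc₁, hc₂, hc₃]
  all_goals simp [pairSum, cyclicMinor]; linarith

theorem stmt15 (q : Tensor) (hq : inM33 q)
    (h000 : 0 < q 0 0 0) (h011 : 0 < q 0 1 1) (h101 : 0 < q 1 0 1) (h110 : 0 < q 1 1 0) :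
    KLdiv uplus q ≥ (1 / 2) * Real.log 2 := by
  have hprod := Real.log_le_log (by positivity) (even_prod_le_of_inM33 hq)
  rw [Real.log_mul (by positivity) h110.ne', Real.log_mul (by positivity) h101.ne',
    Real.log_mul h000.ne' h011.ne', show (1 / 1024 : ℝ) = (2 ^ 10)⁻¹ by norm_num, Real.log_inv,
    Real.log_pow] at hprod
  have hquarter : Real.log (1 / 4) = -(2 * Real.log 2) := by
    rw [show (1 / 4 : ℝ) = (2 ^ 2)⁻¹ by norm_num, Real.log_inv, Real.log_pow]
    norm_num
  have hKL : KLdiv uplus q = 1 / 4 * Real.log (1 / 4 / q 0 0 0) + 1 / 4 * Real.log (1 / 4 / q 0 1 1)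
      + 1 / 4 * Real.log (1 / 4 / q 1 0 1) + 1 / 4 * Real.log (1 / 4 / q 1 1 0) := by
    simp [KLdiv, uplus, Fin.sum_univ_two]
    ring
  rw [hKL, Real.log_div (by norm_num) h000.ne', Real.log_div (by norm_num) h011.ne',
    Real.log_div (by norm_num) h101.ne', Real.log_div (by norm_num) h110.ne', hquarter]
  push_cast at hprod
  linarith
end

section
/- Let p ∈ Δ7 satisfy D(p‖q) ≥ (1/2)·log 2 for every q ∈ M_{3,3} whose support contains the support of p (i.e., p is a maximizer of the divergence to M_{3,3}). Then p = u⁺ or p = u⁻, where u⁺ is the distribution with value 1/4 at the states 000, 011, 101, 110 and 0 elsewhere, and u⁻ is the distribution with value 1/4 at the states 001, 010, 100, 111 and 0 elsewhere. -/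
open Real

/-- The contribution of an entry `x` with marginals `r`, `t` and total mass `s` to the mutual
information. -/
noncomputable def entryInfo (x r t s : ℝ) : ℝ :=
  if 0 < x then x * Real.log (x / (r * t / s)) else 0

lemma entryInfo_le {x r t s : ℝ} (hx : 0 ≤ x) (hr : x ≤ r) (ht : x ≤ t) (hs : x ≤ s) :
    entryInfo x r t s ≤ x * Real.log 2 + s * x / (2 * r) - x ∧
      (entryInfo x r t s = x * Real.log 2 + s * x / (2 * r) - x →
        x = 0 ∨ (x = t ∧ s = 2 * r)) := by
  rcases hx.eq_or_lt with rfl | hx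
  · simp [entryInfo]
  have hr0 : 0 < r := hx.trans_le hr
  have ht0 : 0 < t := hx.trans_le ht
  have hs0 : 0 < s := hx.trans_le hs
  set u : ℝ := x * s / (2 * r * t) with hu
  have hu0 : 0 < u := by positivity
  have hE : entryInfo x r t s = x * Real.log 2 + x * Real.log u := by
    rw [entryInfo, if_pos hx, ← mul_add, ← Real.log_mul (by norm_num) hu0.ne', hu]
    congr 2
    field_simp
  have hle : u ≤ s / (2 * r) := by
    rw [hu, div_le_div_iff₀ (by positivity) (by positivity)]
    nlinarith [mul_le_mul_of_nonneg_left ht (mul_pos hs0 hr0).le]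
  have hlog := Real.log_le_sub_one_of_pos hu0
  have hsplit : x * Real.log 2 + s * x / (2 * r) - x = x * Real.log 2 + x * (s / (2 * r) - 1) := by
    ring
  rw [hE, hsplit]
  refine ⟨by gcongr; linarith, fun h => Or.inr ?_⟩
  have h1 : Real.log u = s / (2 * r) - 1 := mul_left_cancel₀ hx.ne' (add_left_cancel h)
  have hu1 : u = 1 := by
    by_contra hne
    have := Real.log_lt_sub_one_of_pos hu0 hne
    linarith
  have hsr : s / (2 * r) = 1 := by
    rw [hu1, Real.log_one] at h1
    linarith
  have hs2 : s = 2 * r := by rwa [div_eq_one_iff_eq (by positivity)] at hsr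
  refine ⟨?_, hs2⟩
  rw [hu, hs2, div_eq_one_iff_eq (by positivity)] at hu1
  exact mul_left_cancel₀ (show (2 * r) ≠ 0 by positivity) (by linarith)

/-- The (unnormalised) mutual information of a `2 × 2` table. -/
noncomputable def tableInfo (a b c d : ℝ) : ℝ :=
  entryInfo a (a + b) (a + c) (a + b + c + d) + entryInfo b (a + b) (b + d) (a + b + c + d) +
    entryInfo c (c + d) (a + c) (a + b + c + d) + entryInfo d (c + d) (b + d) (a + b + c + d)

lemma tableInfo_le {a b c d : ℝ} (ha : 0 ≤ a) (hb : 0 ≤ b) (hc : 0 ≤ c) (hd : 0 ≤ d) :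
    tableInfo a b c d ≤ (a + b + c + d) * Real.log 2 ∧
      (tableInfo a b c d = (a + b + c + d) * Real.log 2 →
        (a = d ∧ b = 0 ∧ c = 0) ∨ (b = c ∧ a = 0 ∧ d = 0)) := by
  obtain ⟨a1, a2⟩ := entryInfo_le (r := a + b) (t := a + c) (s := a + b + c + d) ha
    (by linarith) (by linarith) (by linarith)
  obtain ⟨b1, b2⟩ := entryInfo_le (r := a + b) (t := b + d) (s := a + b + c + d) hb
    (by linarith) (by linarith) (by linarith)
  obtain ⟨c1, c2⟩ := entryInfo_le (r := c + d) (t := a + c) (s := a + b + c + d) hc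
    (by linarith) (by linarith) (by linarith)
  obtain ⟨d1, d2⟩ := entryInfo_le (r := c + d) (t := b + d) (s := a + b + c + d) hd
    (by linarith) (by linarith) (by linarith)
  have row : ∀ {s x y : ℝ}, 0 ≤ s → s * x / (2 * (x + y)) + s * y / (2 * (x + y)) ≤ s / 2 := by
    intro s x y hs
    rcases eq_or_ne (x + y) 0 with h | h
    · simp only [h, mul_zero, div_zero, add_zero]
      linarith
    · exact le_of_eq (by field_simp)
  have r1 := row (s := a + b + c + d) (x := a) (y := b) (by linarith)
  have r2 := row (s := a + b + c + d) (x := c) (y := d) (by linarith)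
  unfold tableInfo
  refine ⟨by linarith, fun h => ?_⟩
  have a3 := a2 (by linarith)
  have b3 := b2 (by linarith)
  have c3 := c2 (by linarith)
  have d3 := d2 (by linarith)
  grind

/-- The tensor `p` with its slice at `i` replaced by the product of the slice's marginals. -/
noncomputable def sliceProd (p : Tensor) (i : Fin 2) : Tensor := fun i' j k =>
  if i' = i then (p i j 0 + p i j 1) * (p i 0 k + p i 1 k) /
    (p i 0 0 + p i 0 1 + p i 1 0 + p i 1 1) else p i' j k

lemma inM33_sliceProd {p : Tensor} (hp : isDist p) (i : Fin 2) : inM33 (sliceProd p i) := by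
  obtain ⟨h0, h1⟩ := hp
  have hs : 0 ≤ p i 0 0 + p i 0 1 + p i 1 0 + p i 1 1 := by
    linarith [h0 i 0 0, h0 i 0 1, h0 i 1 0, h0 i 1 1]
  refine ⟨⟨fun i' j k => ?_, ?_⟩,
    fun i' j k => (if i' = i then 1 else 0) * (p i j 0 + p i j 1) *
      ((p i 0 k + p i 1 k) / (p i 0 0 + p i 0 1 + p i 1 0 + p i 1 1)),
    fun i' j k => (if i' = i then 0 else 1) * (if j = 0 then 1 else 0) * p (1 - i) 0 k,
    fun i' j k => (if i' = i then 0 else 1) * (if j = 0 then 0 else 1) * p (1 - i) 1 k,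
    ⟨_, _, _, fun i' => ?_, fun j => ?_, fun k => ?_, fun _ _ _ => rfl⟩,
    ⟨_, _, _, fun i' => ?_, fun j => ?_, fun k => ?_, fun _ _ _ => rfl⟩,
    ⟨_, _, _, fun i' => ?_, fun j => ?_, fun k => ?_, fun _ _ _ => rfl⟩, ?_⟩
  · unfold sliceProd
    split_ifs
    · exact div_nonneg (mul_nonneg (add_nonneg (h0 _ _ _) (h0 _ _ _))
        (add_nonneg (h0 _ _ _) (h0 _ _ _))) hs
    · exact h0 _ _ _
  · have key : ∀ a b c d : ℝ, 0 ≤ a → 0 ≤ b → 0 ≤ c → 0 ≤ d →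
        (a + b) * (a + c) / (a + b + c + d) + (a + b) * (b + d) / (a + b + c + d) +
          ((c + d) * (a + c) / (a + b + c + d) + (c + d) * (b + d) / (a + b + c + d)) =
            a + b + c + d := by
      intro a b c d ha hb hc hd
      rcases eq_or_ne (a + b + c + d) 0 with h | h
      · simp [h]
      · field_simp
        ring
    have := key _ _ _ _ (h0 i 0 0) (h0 i 0 1) (h0 i 1 0) (h0 i 1 1)
    fin_cases i <;> simp [sliceProd, Fin.sum_univ_two] at h1 this ⊢ <;> linarith
  · split_ifs <;> norm_num
  · exact add_nonneg (h0 _ _ _) (h0 _ _ _)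
  · exact div_nonneg (add_nonneg (h0 _ _ _) (h0 _ _ _)) hs
  · split_ifs <;> norm_num
  · split_ifs <;> norm_num
  · exact h0 _ _ _
  · split_ifs <;> norm_num
  · split_ifs <;> norm_num
  · exact h0 _ _ _
  · intro i' j k
    fin_cases i <;> fin_cases i' <;> fin_cases j <;> simp [sliceProd, mul_div_assoc]

lemma sliceProd_pos {p : Tensor} (hp : isDist p) (i : Fin 2) (i' j k : Fin 2)
    (h : 0 < p i' j k) : 0 < sliceProd p i i' j k := by
  have h0 := hp.1
  unfold sliceProd
  split_ifs with hi
  · subst hi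
    have e := h0 i'
    have h1 : 0 < p i' j 0 + p i' j 1 := by
      fin_cases k <;> simp at h ⊢ <;> linarith [e j 0, e j 1]
    have h2 : 0 < p i' 0 k + p i' 1 k := by
      fin_cases j <;> simp at h ⊢ <;> linarith [e 0 k, e 1 k]
    have h3 : 0 < p i' 0 0 + p i' 0 1 + p i' 1 0 + p i' 1 1 := by
      fin_cases j <;> simp at h1 <;> linarith [e 0 0, e 0 1, e 1 0, e 1 1]
    positivity
  · exact h

lemma klTerm_self (x : ℝ) : (if 0 < x then x * Real.log (x / x) else 0) = 0 := by
  split_ifs with h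
  · rw [div_self h.ne', Real.log_one, mul_zero]
  · rfl

lemma KLdiv_self (p : Tensor) : KLdiv p p = 0 := by
  simp only [KLdiv, klTerm_self, Finset.sum_const_zero]

lemma KLdiv_sliceProd (p : Tensor) (i : Fin 2) :
    KLdiv p (sliceProd p i) = tableInfo (p i 0 0) (p i 0 1) (p i 1 0) (p i 1 1) := by
  fin_cases i <;>
    simp [KLdiv, sliceProd, Fin.sum_univ_two, tableInfo, entryInfo, add_assoc]

/-- A distribution constant in the first coordinate lies in the model. -/
lemma inM33_of_slices_eq {p : Tensor} (hp : isDist p) (h : ∀ j k, p 1 j k = p 0 j k) :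
    inM33 p := by
  have h0 := hp.1
  refine ⟨hp, fun i j k => 1 * (if j = 0 then 1 else 0) * p 0 0 k,
    fun i j k => 1 * (if j = 0 then 0 else 1) * p 0 1 k, fun i j k => 0 * 0 * 0,
    ⟨_, _, _, fun _ => zero_le_one, fun j => ?_, fun k => ?_, fun _ _ _ => rfl⟩,
    ⟨_, _, _, fun _ => zero_le_one, fun j => ?_, fun k => ?_, fun _ _ _ => rfl⟩,
    ⟨_, _, _, fun _ => le_rfl, fun _ => le_rfl, fun _ => le_rfl, fun _ _ _ => rfl⟩, ?_⟩
  · split_ifs <;> norm_num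
  · exact h0 _ _ _
  · split_ifs <;> norm_num
  · exact h0 _ _ _
  · intro i j k
    fin_cases i <;> fin_cases j <;> simp [h]

theorem stmt17 (p : Tensor) (hp : isDist p)
    (hmax : ∀ q : Tensor, inM33 q → (∀ i j k, 0 < p i j k → 0 < q i j k) →
      (1 / 2) * Real.log 2 ≤ KLdiv p q) :
    p = uplus ∨ p = uminus := by
  have hlog : 0 < Real.log 2 := Real.log_pos (by norm_num)
  have hT : ∀ i, _ := fun i => tableInfo_le (hp.1 i 0 0) (hp.1 i 0 1) (hp.1 i 1 0) (hp.1 i 1 1)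
  have hI : ∀ i, (1 / 2) * Real.log 2 ≤ tableInfo (p i 0 0) (p i 0 1) (p i 1 0) (p i 1 1) :=
    fun i => KLdiv_sliceProd p i ▸ hmax _ (inM33_sliceProd hp i) (sliceProd_pos hp i)
  have hS : ∀ i, 1 / 2 ≤ p i 0 0 + p i 0 1 + p i 1 0 + p i 1 1 := fun i =>
    le_of_mul_le_mul_right ((hI i).trans (hT i).1) hlog
  have hsum := hp.2
  simp only [Fin.sum_univ_two] at hsum
  have hS' : ∀ i, p i 0 0 + p i 0 1 + p i 1 0 + p i 1 1 = 1 / 2 := by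
    intro i
    have := hS 0
    have := hS 1
    fin_cases i <;> simp <;> linarith
  have hD := fun i => (hT i).2 (le_antisymm (hT i).1 ((hS' i).symm ▸ hI i))
  have hne : ¬ ∀ j k, p 1 j k = p 0 j k := by
    intro h
    have := hmax p (inM33_of_slices_eq hp h) (fun _ _ _ h => h)
    rw [KLdiv_self] at this
    linarith
  have e0 := hS' 0
  have e1 := hS' 1
  rcases hD 0 with ⟨a1, a2, a3⟩ | ⟨a1, a2, a3⟩ <;> rcases hD 1 with ⟨b1, b2, b3⟩ | ⟨b1, b2, b3⟩
  · refine absurd (fun j k => ?_) hne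
    fin_cases j <;> fin_cases k <;> simp <;> linarith
  · left
    funext i j k
    fin_cases i <;> fin_cases j <;> fin_cases k <;> simp [uplus] <;> linarith
  · right
    funext i j k
    fin_cases i <;> fin_cases j <;> fin_cases k <;> simp [uminus] <;> linarith
  · refine absurd (fun j k => ?_) hne
    fin_cases j <;> fin_cases k <;> simp <;> linarith
end

section
/- Let p ∈ Δ7 be strictly positive and suppose each of the four states 000, 011, 101, 110 is a mode of p. Then the following six strict inequalities hold: p_{000}p_{011} > p_{001}p_{010}, p_{101}p_{110} > p_{100}p_{111}, p_{000}p_{101} > p_{001}p_{100}, p_{011}p_{110} > p_{010}p_{111}, p_{000}p_{110} > p_{010}p_{100}, and p_{011}p_{101} > p_{001}p_{111}. In particular, none of the six conditions C1–C6 holds for p. -/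
open Real

/-- A state of three binary random variables. -/
abbrev State : Type := Fin 2 × Fin 2 × Fin 2

/-- Two states are Hamming neighbours if they differ in exactly one coordinate. -/
def hamNeighbour (x y : State) : Prop :=
  (x.1 ≠ y.1 ∧ x.2.1 = y.2.1 ∧ x.2.2 = y.2.2) ∨
  (x.1 = y.1 ∧ x.2.1 ≠ y.2.1 ∧ x.2.2 = y.2.2) ∨
  (x.1 = y.1 ∧ x.2.1 = y.2.1 ∧ x.2.2 ≠ y.2.2)

/-- `x` is a mode of `p` if `p` is strictly larger at `x` than at every Hamming neighbour. -/
def isMode (p : Tensor) (x : State) : Prop :=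
  ∀ y : State, hamNeighbour x y → p y.1 y.2.1 y.2.2 < p x.1 x.2.1 x.2.2

theorem stmt18 (p : Tensor) (hp : isDist p) (hpos : ∀ i j k, 0 < p i j k)
    (h1 : isMode p (0, 0, 0)) (h2 : isMode p (0, 1, 1))
    (h3 : isMode p (1, 0, 1)) (h4 : isMode p (1, 1, 0)) :
    (p 0 0 0 * p 0 1 1 > p 0 0 1 * p 0 1 0 ∧
     p 1 0 1 * p 1 1 0 > p 1 0 0 * p 1 1 1 ∧
     p 0 0 0 * p 1 0 1 > p 0 0 1 * p 1 0 0 ∧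
     p 0 1 1 * p 1 1 0 > p 0 1 0 * p 1 1 1 ∧
     p 0 0 0 * p 1 1 0 > p 0 1 0 * p 1 0 0 ∧
     p 0 1 1 * p 1 0 1 > p 0 0 1 * p 1 1 1) ∧
    ¬ (C1 p ∨ C2 p ∨ C3 p ∨ C4 p ∨ C5 p ∨ C6 p) := by
  have e1 : p 0 0 0 * p 0 1 1 > p 0 0 1 * p 0 1 0 :=
    mul_lt_mul'' (h1 (0, 0, 1) (by simp [hamNeighbour])) (h2 (0, 1, 0) (by simp [hamNeighbour]))
      (hpos _ _ _).le (hpos _ _ _).le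
  have e2 : p 1 0 1 * p 1 1 0 > p 1 0 0 * p 1 1 1 :=
    mul_lt_mul'' (h3 (1, 0, 0) (by simp [hamNeighbour])) (h4 (1, 1, 1) (by simp [hamNeighbour]))
      (hpos _ _ _).le (hpos _ _ _).le
  have e3 : p 0 0 0 * p 1 0 1 > p 0 0 1 * p 1 0 0 :=
    mul_lt_mul'' (h1 (0, 0, 1) (by simp [hamNeighbour])) (h3 (1, 0, 0) (by simp [hamNeighbour]))
      (hpos _ _ _).le (hpos _ _ _).le
  have e4 : p 0 1 1 * p 1 1 0 > p 0 1 0 * p 1 1 1 :=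
    mul_lt_mul'' (h2 (0, 1, 0) (by simp [hamNeighbour])) (h4 (1, 1, 1) (by simp [hamNeighbour]))
      (hpos _ _ _).le (hpos _ _ _).le
  have e5 : p 0 0 0 * p 1 1 0 > p 0 1 0 * p 1 0 0 :=
    mul_lt_mul'' (h1 (0, 1, 0) (by simp [hamNeighbour])) (h4 (1, 0, 0) (by simp [hamNeighbour]))
      (hpos _ _ _).le (hpos _ _ _).le
  have e6 : p 0 1 1 * p 1 0 1 > p 0 0 1 * p 1 1 1 :=
    mul_lt_mul'' (h2 (0, 0, 1) (by simp [hamNeighbour])) (h3 (1, 1, 1) (by simp [hamNeighbour]))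
      (hpos _ _ _).le (hpos _ _ _).le
  refine ⟨⟨e1, e2, e3, e4, e5, e6⟩, ?_⟩
  rintro (h | h | h | h | h | h) <;> obtain ⟨ha, hb⟩ := h <;> linarith
end
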